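/- arXiv:1304.5450 — 4 statements merged into one kernel-verified Lean document; each statement's English description precedes it below -/
import Mathlib

section
/- Let H be a non-abelian finite simple group, and suppose there are ordered pairs (T_{1,s}, T_{2,s}), s = 1,…,t, of generating triples of H such that: (1) for every prime p dividing |H| there is some s for which T_{1,s} and T_{2,s} are a strongly p-distinguishing pair; and (2) for each i = 1, 2, the 3t triples consisting of T_{i,1},…,T_{i,t} together with all their cyclic permutations are pairwise inequivalent under Aut(H). Then for every integer k with 3t ≤ k and k·|Aut H| ≤ φ₂(H), the direct power Hᵏ admits an unmixed Beauville structure. -/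
open scoped MatrixGroups

/-- `Σ(T)`: the union of all conjugates of the cyclic subgroups generated by the
three entries of the triple `T = (a, b, c)`. -/
def SigmaSet {G : Type*} [Group G] (T : G × G × G) : Set G :=
  {x | ∃ g : G, g * x * g⁻¹ ∈
    (Subgroup.zpowers T.1 : Set G) ∪ (Subgroup.zpowers T.2.1 : Set G) ∪
      (Subgroup.zpowers T.2.2 : Set G)}

/-- `T = (a,b,c)` is a generating triple: `a*b*c = 1` and `{a,b,c}` generates. -/
def IsGenTriple {G : Type*} [Group G] (T : G × G × G) : Prop :=
  T.1 * T.2.1 * T.2.2 = 1 ∧ Subgroup.closure {T.1, T.2.1, T.2.2} = ⊤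

/-- `T` is hyperbolic: the reciprocals of the orders of its entries sum to less than 1. -/
def IsHyperbolic {G : Type*} [Group G] (T : G × G × G) : Prop :=
  (orderOf T.1 : ℚ)⁻¹ + (orderOf T.2.1 : ℚ)⁻¹ + (orderOf T.2.2 : ℚ)⁻¹ < 1

/-- An unmixed Beauville structure on `G`: a pair of hyperbolic generating triples
`T₁, T₂` with `Σ(T₁) ∩ Σ(T₂) = {1}`. -/
def HasBeauvilleStructure (G : Type*) [Group G] : Prop :=
  ∃ T₁ T₂ : G × G × G, IsGenTriple T₁ ∧ IsHyperbolic T₁ ∧ IsGenTriple T₂ ∧ IsHyperbolic T₂ ∧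
    SigmaSet T₁ ∩ SigmaSet T₂ = {1}

/-- `φ₂(H)`: the number of ordered generating pairs of `H`. -/
noncomputable def phi2 (H : Type*) [Group H] : ℕ :=
  Nat.card {p : H × H // Subgroup.closure {p.1, p.2} = ⊤}

/-- Two triples are equivalent if some automorphism carries one to the other entrywise. -/
def TripleEquiv {H : Type*} [Group H] (T T' : H × H × H) : Prop :=
  ∃ α : MulAut H, α T.1 = T'.1 ∧ α T.2.1 = T'.2.1 ∧ α T.2.2 = T'.2.2

/-- The `p`-summit of `d ∈ Hᵏ`: the set of indices at which the `p`-adic valuation of the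
order of the coordinate attains its maximum over all coordinates. -/
def pSummit {H : Type*} [Group H] {k : ℕ} (p : ℕ) (d : Fin k → H) : Set (Fin k) :=
  {j | ∀ j', (orderOf (d j')).factorization p ≤ (orderOf (d j)).factorization p}

/-- An element `h` of `H` is `p`-full if the highest power of `p` dividing the exponent of
`H` divides the order of `h`. -/
def PFull (H : Type*) [Group H] (p : ℕ) (h : H) : Prop :=
  p ^ (Monoid.exponent H).factorization p ∣ orderOf h

open scoped Classical in
/-- `ν_p(T)`: the number of `p`-full entries of the triple `T`. -/
noncomputable def nuP {H : Type*} [Group H] (p : ℕ) (T : H × H × H) : ℕ :=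
  (if PFull H p T.1 then 1 else 0) + (if PFull H p T.2.1 then 1 else 0) +
    (if PFull H p T.2.2 then 1 else 0)

/-- Two triples are `p`-distinguishing if `ν_p(T₁) ≠ ν_p(T₂)`. -/
def PDistinguishing {H : Type*} [Group H] (p : ℕ) (T₁ T₂ : H × H × H) : Prop :=
  nuP p T₁ ≠ nuP p T₂

/-- Two triples are strongly `p`-distinguishing if they are `p`-distinguishing and whenever
`ν_p(T_i) = 0` then either `p²` does not divide the exponent of `H` or `p` divides none of
the orders of the entries of `T_i`. -/
def StronglyPDistinguishing {H : Type*} [Group H] (p : ℕ) (T₁ T₂ : H × H × H) : Prop :=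
  PDistinguishing p T₁ T₂ ∧
    ∀ T ∈ ({T₁, T₂} : Set (H × H × H)), nuP p T = 0 →
      ¬ (p ^ 2 ∣ Monoid.exponent H) ∨
        (¬ p ∣ orderOf T.1 ∧ ¬ p ∣ orderOf T.2.1 ∧ ¬ p ∣ orderOf T.2.2)

/-- The cyclic shift of a triple: `(x, y, z) ↦ (y, z, x)`. -/
def cycShift {H : Type*} (T : H × H × H) : H × H × H := (T.2.1, T.2.2, T.1)

section Generation

variable {H K : Type*} [Group H] [IsSimpleGroup H] [Group K]

/-- Either one of two epimorphisms onto a finite simple group factors through the other, or the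
kernel of the first surjects under the second. -/
lemma map_ker_eq_top [Finite H] {f g : K →* H} (hf : Function.Surjective f)
    (hg : Function.Surjective g) (h : ¬ ∃ α : MulAut H, ∀ x, α (f x) = g x) :
    f.ker.map g = ⊤ := by
  have hN : (f.ker.map g).Normal := Subgroup.Normal.map inferInstance g hg
  rcases hN.eq_bot_or_eq_top with hbot | htop
  · exfalso
    apply h
    have hle : f.ker ≤ g.ker := (Subgroup.map_eq_bot_iff _).1 hbot
    let β : H →* H := f.liftOfSurjective hf ⟨g, hle⟩
    have hβ : ∀ x, β (f x) = g x := fun x =>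
      f.liftOfRightInverse_comp_apply _ (Function.rightInverse_surjInv hf) ⟨g, hle⟩ x
    have hsurj : Function.Surjective β := fun y => by
      obtain ⟨x, rfl⟩ := hg y
      exact ⟨f x, hβ x⟩
    exact ⟨MulEquiv.ofBijective β (Finite.surjective_iff_bijective.1 hsurj), hβ⟩
  · exact htop

open scoped commutatorElement in
lemma map_inf_eq_top (hna : ¬ ∀ x y : H, x * y = y * x) {M N : Subgroup K} [M.Normal] [N.Normal]
    {f : K →* H} (hf : Function.Surjective f) (hM : M.map f = ⊤) (hN : N.map f = ⊤) :
    (M ⊓ N).map f = ⊤ := by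
  have hI : ((M ⊓ N).map f).Normal := Subgroup.Normal.map inferInstance f hf
  refine hI.eq_bot_or_eq_top.resolve_left fun hbot => hna fun x y => ?_
  obtain ⟨m, hm, rfl⟩ : x ∈ M.map f := hM ▸ Subgroup.mem_top x
  obtain ⟨n, hn, rfl⟩ : y ∈ N.map f := hN ▸ Subgroup.mem_top y
  have hmem : ⁅m, n⁆ ∈ M ⊓ N :=
    Subgroup.commutator_le_inf M N (Subgroup.commutator_mem_commutator hm hn)
  have h1 : f ⁅m, n⁆ = 1 := by
    have := Subgroup.mem_map_of_mem f hmem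
    rwa [hbot, Subgroup.mem_bot] at this
  rw [map_commutatorElement] at h1
  exact commutatorElement_eq_one_iff_mul_comm.1 h1

lemma map_iInf_ker_eq_top (hna : ¬ ∀ x y : H, x * y = y * x) {ι : Type*} (f : ι → K →* H)
    (i : ι) (hf : Function.Surjective (f i)) (S : Finset ι)
    (h : ∀ j ∈ S, (f j).ker.map (f i) = ⊤) : (⨅ j ∈ S, (f j).ker).map (f i) = ⊤ := by
  classical
  induction S using Finset.induction_on with
  | empty => simpa [← MonoidHom.range_eq_map] using (f i).range_eq_top.2 hf
  | insert j S _ ih =>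
    rw [Finset.iInf_insert]
    have : (⨅ l ∈ S, (f l).ker).Normal :=
      Subgroup.normal_iInf_normal fun l => Subgroup.normal_iInf_normal fun _ => inferInstance
    exact map_inf_eq_top hna hf (h j (Finset.mem_insert_self j S))
      (ih fun l hl => h l (Finset.mem_insert_of_mem hl))

/-- A subgroup of a power of a finite nonabelian simple group which surjects onto every factor,
and in which no two coordinates are linked by an automorphism, is everything. -/
lemma subgroup_eq_top_of_not_linked [Finite H] (hna : ¬ ∀ x y : H, x * y = y * x) {ι : Type*}
    [Finite ι] (L : Subgroup (ι → H))
    (hsurj : ∀ i, Function.Surjective ((Pi.evalMonoidHom (fun _ => H) i).comp L.subtype))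
    (h : ∀ i j, i ≠ j → ¬ ∃ α : MulAut H, ∀ x ∈ L, α (x i) = x j) : L = ⊤ := by
  classical
  have := Fintype.ofFinite ι
  refine (Subgroup.eq_top_iff' L).2 fun x => Subgroup.pi_mem_of_mulSingle_mem x fun i => ?_
  have hmap := map_iInf_ker_eq_top hna
    (fun i => (Pi.evalMonoidHom (fun _ => H) i).comp L.subtype) i (hsurj i)
    (Finset.univ.erase i) fun j hj =>
      map_ker_eq_top (hsurj j) (hsurj i) fun ⟨α, hα⟩ =>
        h j i (Finset.ne_of_mem_erase hj) ⟨α, fun y hy => hα ⟨y, hy⟩⟩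
  obtain ⟨y, hy, hyx⟩ := hmap.symm ▸ Subgroup.mem_top (x i)
  have hy' : ∀ j, j ≠ i → (y : ι → H) j = 1 := fun j hj => by
    have := hy
    simp only [SetLike.mem_coe, Subgroup.mem_iInf] at this
    exact this j (Finset.mem_erase.2 ⟨hj, Finset.mem_univ j⟩)
  convert y.2 using 1
  funext j
  rcases eq_or_ne j i with rfl | hj
  · simpa using hyx.symm
  · simp [hj, hy' j hj]

end Generation

/-- The triple in the power `ι → H` with the given coordinate triples. -/
def piTriple {ι H : Type*} (U : ι → H × H × H) : (ι → H) × (ι → H) × (ι → H) :=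
  (fun i => (U i).1, fun i => (U i).2.1, fun i => (U i).2.2)

lemma isGenTriple_piTriple {H ι : Type*} [Group H] [Finite H] [IsSimpleGroup H] [Finite ι]
    (hna : ¬ ∀ x y : H, x * y = y * x) (U : ι → H × H × H) (hU : ∀ i, IsGenTriple (U i))
    (hne : ∀ i j, i ≠ j → ¬ TripleEquiv (U i) (U j)) : IsGenTriple (piTriple U) := by
  refine ⟨funext fun i => (hU i).1, subgroup_eq_top_of_not_linked hna _ (fun i => ?_) ?_⟩
  · rw [← MonoidHom.range_eq_top, MonoidHom.range_comp, Subgroup.range_subtype,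
      MonoidHom.map_closure, ← (hU i).2]
    simp [Set.image_insert_eq, piTriple]
  · rintro i j hij ⟨α, hα⟩
    exact hne i j hij ⟨α, hα (piTriple U).1 (Subgroup.subset_closure (by simp)),
      hα (piTriple U).2.1 (Subgroup.subset_closure (by simp)),
      hα (piTriple U).2.2 (Subgroup.subset_closure (by simp))⟩

section Hyperbolic

variable {H : Type*} [Group H]

lemma mul_comm_of_closure_pair {a b : H} (hgen : Subgroup.closure {a, b} = ⊤)
    (hab : a * b = b * a) (x y : H) : x * y = y * x := by
  have hcomm := Subgroup.isMulCommutative_closure (k := {a, b}) (by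
    rintro x (rfl | rfl) y (rfl | rfl) <;> simp [hab])
  have hx : x ∈ Subgroup.closure {a, b} := hgen ▸ Subgroup.mem_top x
  have hy : y ∈ Subgroup.closure {a, b} := hgen ▸ Subgroup.mem_top y
  exact congrArg Subtype.val (hcomm.is_comm.comm ⟨x, hx⟩ ⟨y, hy⟩)

lemma IsGenTriple.closure_pair {T : H × H × H} (hT : IsGenTriple T) :
    Subgroup.closure {T.1, T.2.1} = ⊤ := by
  rw [eq_top_iff, ← hT.2, Subgroup.closure_le]
  have h1 : T.1 ∈ Subgroup.closure {T.1, T.2.1} := Subgroup.subset_closure (by simp)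
  have h2 : T.2.1 ∈ Subgroup.closure {T.1, T.2.1} := Subgroup.subset_closure (by simp)
  rintro x (rfl | rfl | rfl)
  · exact h1
  · exact h2
  · have : T.2.2 = (T.1 * T.2.1)⁻¹ := (inv_eq_of_mul_eq_one_right hT.1).symm
    rw [this]
    exact inv_mem (mul_mem h1 h2)

/-- A simple group which is a quotient of the triangle group `Δ(3, 3, 3)` is abelian. -/
lemma mul_comm_of_triangle_three [IsSimpleGroup H] {a b : H}
    (hgen : Subgroup.closure {a, b} = ⊤) (ha : a ^ 3 = 1) (hb : b ^ 3 = 1)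
    (hab : (a * b) ^ 3 = 1) (x y : H) : x * y = y * x := by
  have ha' : a * a = a⁻¹ := eq_inv_of_mul_eq_one_left (by rw [← ha, pow_three, mul_assoc])
  have hb' : b⁻¹ * b⁻¹ = b := by
    have : b * b = b⁻¹ := eq_inv_of_mul_eq_one_left (by rw [← hb, pow_three, mul_assoc])
    rw [← mul_inv_rev, this, inv_inv]
  have hbab : b * a * b = a⁻¹ * b⁻¹ * a⁻¹ := by
    have : a * (b * a * b) * a * b = 1 := by rw [← hab]; simp [pow_succ, mul_assoc]
    have h2 : b * a * b = a⁻¹ * 1 * b⁻¹ * a⁻¹ := by rw [← this]; group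
    simpa using h2
  have haba : a * b * a = b⁻¹ * a⁻¹ * b⁻¹ := by
    have : a * b * a * (b * a * b) = 1 := by rw [← hab]; simp [pow_succ, mul_assoc]
    rw [eq_inv_of_mul_eq_one_left this]; group
  set u := a * b⁻¹ with hu
  set v := b⁻¹ * a with hv
  have huv : u * v = a * b * a := by
    rw [hu, hv, show a * b⁻¹ * (b⁻¹ * a) = a * (b⁻¹ * b⁻¹) * a by group, hb']
  have hvu : v * u = a * b * a := by
    rw [hu, hv, show b⁻¹ * a * (a * b⁻¹) = b⁻¹ * (a * a) * b⁻¹ by group, ha', haba]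
  set N := Subgroup.closure {u, v} with hNdef
  have hmu : u ∈ N := Subgroup.subset_closure (by simp)
  have hmv : v ∈ N := Subgroup.subset_closure (by simp)
  have hmw : b * a * b ∈ N := by
    have : b * a * b = (u * v)⁻¹ := by rw [huv, hbab]; group
    rw [this]
    exact inv_mem (mul_mem hmu hmv)
  have key : ∀ g : H, g * u * g⁻¹ ∈ N → g * v * g⁻¹ ∈ N → ∀ n ∈ N, g * n * g⁻¹ ∈ N := by
    intro g hgu hgv
    have : N ≤ N.comap (MulAut.conj g).toMonoidHom := by
      rw [hNdef, Subgroup.closure_le]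
      rintro x (rfl | rfl)
      exacts [hgu, hgv]
    exact fun n hn => this hn
  have hNa : ∀ n ∈ N, a * n * a⁻¹ ∈ N := by
    refine key a ?_ ?_
    · rwa [hu, show a * (a * b⁻¹) * a⁻¹ = (a * a) * b⁻¹ * a⁻¹ by group, ha', ← hbab]
    · rwa [hv, show a * (b⁻¹ * a) * a⁻¹ = a * b⁻¹ by group]
  have hNb : ∀ n ∈ N, b * n * b⁻¹ ∈ N := by
    refine key b ?_ ?_
    · rwa [hu, show b * (a * b⁻¹) * b⁻¹ = b * a * (b⁻¹ * b⁻¹) by group, hb']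
    · rwa [hv, show b * (b⁻¹ * a) * b⁻¹ = a * b⁻¹ by group]
  have hcube : ∀ g : H, g ^ 3 = 1 → (∀ n ∈ N, g * n * g⁻¹ ∈ N) →
      g ∈ Subgroup.normalizer (N : Set H) := by
    intro g hg hgN
    refine Subgroup.mem_normalizer_iff.2 fun n => ⟨hgN n, fun hn => ?_⟩
    have h3 := hgN _ (hgN _ hn)
    have : g * (g * (g * n * g⁻¹) * g⁻¹) * g⁻¹ = g ^ 3 * n * (g ^ 3)⁻¹ := by
      simp [pow_three, mul_assoc]
    simpa [this, hg] using h3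
  have hNn : N.Normal := by
    rw [← Subgroup.normalizer_eq_top_iff, eq_top_iff, ← hgen, Subgroup.closure_le]
    rintro x (rfl | rfl)
    exacts [hcube _ ha hNa, hcube _ hb hNb]
  rcases hNn.eq_bot_or_eq_top with hbot | htop
  · have hu1 : u = 1 := by rwa [hbot, Subgroup.mem_bot] at hmu
    have : a = b := mul_inv_eq_one.1 hu1
    exact mul_comm_of_closure_pair hgen (by rw [this]) x y
  · exact mul_comm_of_closure_pair htop (huv.trans hvu.symm) x y

lemma IsGenTriple.four_le_of_pow_eq_one [IsSimpleGroup H] (hna : ¬ ∀ x y : H, x * y = y * x)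
    {T : H × H × H} (hT : IsGenTriple T) {n : ℕ} (hn : 0 < n) (h1 : T.1 ^ n = 1)
    (h2 : T.2.1 ^ n = 1) (h3 : T.2.2 ^ n = 1) : 4 ≤ n := by
  by_contra! hlt
  apply hna
  have hab : (T.1 * T.2.1) ^ n = 1 := by
    rw [eq_inv_of_mul_eq_one_left hT.1, inv_pow, h3, inv_one]
  interval_cases n
  · exact mul_comm_of_closure_pair hT.closure_pair (by simp_all)
  · refine mul_comm_of_closure_pair hT.closure_pair ?_
    rw [pow_two] at h1 h2 hab
    have := eq_inv_of_mul_eq_one_left hab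
    rwa [mul_inv_rev, ← eq_inv_of_mul_eq_one_left h1, ← eq_inv_of_mul_eq_one_left h2] at this
  · exact mul_comm_of_triangle_three hT.closure_pair h1 h2 hab

lemma IsHyperbolic.of_four_le {T : H × H × H} (h1 : 4 ≤ orderOf T.1) (h2 : 4 ≤ orderOf T.2.1)
    (h3 : 4 ≤ orderOf T.2.2) : IsHyperbolic T := by
  have key : ∀ n : ℕ, 4 ≤ n → (n : ℚ)⁻¹ ≤ 1 / 4 := fun n hn => by
    rw [← one_div]
    exact one_div_le_one_div_of_le (by norm_num) (by exact_mod_cast hn)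
  have := key _ h1
  have := key _ h2
  have := key _ h3
  unfold IsHyperbolic
  linarith

end Hyperbolic

section Extension

variable {H : Type*} [Group H]

/-- Equivalence under automorphisms, as a setoid on the generating triples. -/
def genTripleSetoid (H : Type*) [Group H] : Setoid {T : H × H × H // IsGenTriple T} where
  r T T' := TripleEquiv T.1 T'.1
  iseqv :=
    { refl := fun _ => ⟨1, rfl, rfl, rfl⟩
      symm := fun ⟨α, h1, h2, h3⟩ => ⟨α⁻¹, by simp [← h1], by simp [← h2], by simp [← h3]⟩
      trans := fun ⟨α, h1, h2, h3⟩ ⟨β, h1', h2', h3'⟩ =>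
        ⟨β * α, by simp [h1, h1'], by simp [h2, h2'], by simp [h3, h3']⟩ }

lemma phi2_le_card_genTriple [Finite H] :
    phi2 H ≤ Nat.card {T : H × H × H // IsGenTriple T} := by
  refine Nat.card_le_card_of_injective
    (fun p => ⟨(p.1.1, p.1.2, (p.1.1 * p.1.2)⁻¹), by simp, ?_⟩) ?_
  · exact top_le_iff.1 (p.2.ge.trans (Subgroup.closure_mono (by simp [Set.insert_subset_iff])))
  · rintro ⟨⟨a, b⟩, _⟩ ⟨⟨c, d⟩, _⟩ h
    have h' := Prod.mk.inj (congrArg Subtype.val h)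
    exact Subtype.ext (Prod.ext h'.1 (Prod.mk.inj h'.2).1)

lemma le_card_quotient_genTriple [Finite H] {k : ℕ} (hk : k * Nat.card (MulAut H) ≤ phi2 H) :
    k ≤ Nat.card (Quotient (genTripleSetoid H)) := by
  have : Finite (MulAut H) := Finite.of_injective (fun α : MulAut H => (α : H → H))
    DFunLike.coe_injective
  refine Nat.le_of_mul_le_mul_right (hk.trans (phi2_le_card_genTriple.trans ?_))
    (Nat.card_pos (α := MulAut H))
  rw [← Nat.card_prod]
  have hex : ∀ T : {T : H × H × H // IsGenTriple T}, ∃ α : MulAut H,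
      α ((Quotient.mk (genTripleSetoid H) T).out).1.1 = T.1.1 ∧
      α ((Quotient.mk (genTripleSetoid H) T).out).1.2.1 = T.1.2.1 ∧
      α ((Quotient.mk (genTripleSetoid H) T).out).1.2.2 = T.1.2.2 :=
    fun T => Quotient.mk_out (s := genTripleSetoid H) T
  choose α hα using hex
  refine Nat.card_le_card_of_injective
    (fun T => (Quotient.mk (genTripleSetoid H) T, α T)) fun T T' h => ?_
  simp only [Prod.mk.injEq] at h
  have h1 := hα T
  have h2 := hα T'
  rw [h.1, h.2] at h1
  exact Subtype.ext (Prod.ext (h1.1.symm.trans h2.1)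
    (Prod.ext (h1.2.1.symm.trans h2.2.1) (h1.2.2.symm.trans h2.2.2)))

/-- A family of pairwise inequivalent generating triples extends to a family of `k` such
triples as soon as `k` does not exceed the number of equivalence classes. -/
lemma exists_extension_genTriple [Finite H] {k : ℕ}
    (hk : k * Nat.card (MulAut H) ≤ phi2 H) {J : Type*} (ι : J ↪ Fin k) (V : J → H × H × H)
    (hV : ∀ j, IsGenTriple (V j)) (hne : ∀ i j, i ≠ j → ¬ TripleEquiv (V i) (V j)) :
    ∃ U : Fin k → H × H × H, (∀ i, IsGenTriple (U i)) ∧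
      (∀ i j, i ≠ j → ¬ TripleEquiv (U i) (U j)) ∧ ∀ j, U (ι j) = V j := by
  classical
  let Q := Quotient (genTripleSetoid H)
  have := Fintype.ofFinite Q
  have := Finite.of_injective ι ι.injective
  have := Fintype.ofFinite J
  have hkQ : k ≤ Fintype.card Q := by
    rw [← Nat.card_eq_fintype_card]
    exact le_card_quotient_genTriple hk
  let q : J → Q := fun j => Quotient.mk (genTripleSetoid H) ⟨V j, hV j⟩
  have hq : Function.Injective q := fun i j h => by
    by_contra hij
    exact hne i j hij (Quotient.exact (s := genTripleSetoid H) h)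
  have hJ : (Finset.univ.image q).card ≤ k := by
    rw [Finset.card_image_of_injective _ hq, Finset.card_univ]
    simpa using Fintype.card_le_of_injective ι ι.injective
  obtain ⟨S, hqS, hS⟩ := Finset.exists_superset_card_eq hJ hkQ
  obtain ⟨g, hginj, hg⟩ : ∃ g : Fin k → Q, Function.Injective g ∧ ∀ j, g (ι j) = q j := by
    let e : Fin k ≃ S := Fintype.equivOfCardEq (by simp [hS])
    obtain ⟨g, hg⟩ := Finset.exists_equiv_extend_of_card_eq (t := S) (by simp [hS])
      (s := Finset.univ.map ι) (f := Function.extend ι q fun i => (e i : Q))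
      (by
        intro x hx
        simp only [Finset.mem_image, Finset.mem_map, Finset.mem_univ, true_and] at hx
        obtain ⟨_, ⟨j, rfl⟩, rfl⟩ := hx
        rw [ι.injective.extend_apply]
        exact hqS (Finset.mem_image_of_mem q (Finset.mem_univ j)))
      (by
        intro x hx y hy hxy
        simp only [Finset.coe_map, Finset.coe_univ, Set.image_univ, Set.mem_range] at hx hy
        obtain ⟨i, rfl⟩ := hx
        obtain ⟨j, rfl⟩ := hy
        rw [ι.injective.extend_apply, ι.injective.extend_apply] at hxy
        rw [hq hxy])
    refine ⟨fun i => g i, Subtype.val_injective.comp g.injective, fun j => ?_⟩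
    simpa [ι.injective.extend_apply] using hg (ι j) (by simp)
  let W : Fin k → {T : H × H × H // IsGenTriple T} :=
    Function.extend ι (fun j => ⟨V j, hV j⟩) fun i => (g i).out
  have hW : ∀ i, Quotient.mk (genTripleSetoid H) (W i) = g i := fun i => by
    by_cases hi : ∃ j, ι j = i
    · obtain ⟨j, rfl⟩ := hi
      rw [hg, show W (ι j) = ⟨V j, hV j⟩ from ι.injective.extend_apply _ _ j]
    · rw [show W i = (g i).out from Function.extend_apply' _ _ _ hi]
      exact Quotient.out_eq _
  refine ⟨fun i => (W i).1, fun i => (W i).2, fun i j hij h => hij (hginj ?_), fun j => ?_⟩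
  · rw [← hW i, ← hW j]
    exact Quotient.sound (s := genTripleSetoid H) h
  · exact congrArg Subtype.val (show W (ι j) = ⟨V j, hV j⟩ from ι.injective.extend_apply _ _ j)

end Extension

section Support

lemma dvd_of_dvd_mul_prime {p m n f : ℕ} (hp : p.Prime) (hm : m ∣ n * p) (hn : p ^ f ∣ n)
    (hf : ¬ p ^ (f + 1) ∣ m) : m ∣ n := by
  have hm0 : m ≠ 0 := by
    rintro rfl
    exact hf (dvd_zero _)
  obtain ⟨a, c, hc, rfl⟩ := Nat.exists_eq_pow_mul_and_not_dvd hm0 p hp.ne_one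
  have ha : a ≤ f := by
    by_contra! h
    exact hf (Dvd.dvd.mul_right (pow_dvd_pow p h) c)
  have hcop : Nat.Coprime p c := (Nat.Prime.coprime_iff_not_dvd hp).2 hc
  exact Nat.Coprime.mul_dvd_of_dvd_of_dvd (hcop.pow_left a) ((pow_dvd_pow p ha).trans hn)
    (hcop.symm.dvd_of_dvd_mul_right ((Dvd.intro_left _ rfl).trans hm))

variable {H : Type*} [Group H] [Finite H]

lemma exponent_factorization_pos {p : ℕ} (hp : p.Prime) (hpH : p ∣ Nat.card H) :
    0 < (Monoid.exponent H).factorization p := by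
  have := Fact.mk hp
  obtain ⟨x, hx⟩ := exists_prime_orderOf_dvd_card' p hpH
  exact hp.factorization_pos_of_dvd Monoid.exponent_ne_zero_of_finite
    (hx ▸ Monoid.order_dvd_exponent x)

lemma not_pow_succ_dvd_orderOf {p : ℕ} (hp : p.Prime) (x : H) :
    ¬ p ^ ((Monoid.exponent H).factorization p + 1) ∣ orderOf x := fun h =>
  Nat.pow_succ_factorization_not_dvd Monoid.exponent_ne_zero_of_finite hp
    (h.trans (Monoid.order_dvd_exponent x))

/-- A `p`-full coordinate of `d` stays nontrivial in every power of `d` of order `p`. -/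
lemma PFull.pow_ne_one {ι : Type*} {p n : ℕ} (hp : p.Prime) {d : ι → H}
    (hd : orderOf (d ^ n) = p) {j : ι} (hj : PFull H p (d j)) : d j ^ n ≠ 1 := by
  intro h
  have h1 : d ^ n = 1 := by
    funext i
    refine orderOf_dvd_iff_pow_eq_one.1 (dvd_of_dvd_mul_prime hp ?_
      (hj.trans (orderOf_dvd_of_pow_eq_one h)) (not_pow_succ_dvd_orderOf hp (d i)))
    refine orderOf_dvd_of_pow_eq_one ?_
    have := congrFun (pow_orderOf_eq_one (d ^ n)) i
    rwa [hd, ← pow_mul] at this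
  rw [h1, orderOf_one] at hd
  exact hp.ne_one hd.symm

/-- If some coordinate of `d` is `p`-full, then the support of a power of `d` of order `p`
consists of the `p`-full coordinates. -/
lemma PFull.of_pow_ne_one {ι : Type*} {p n : ℕ} (hp : p.Prime) (hpH : p ∣ Nat.card H)
    {d : ι → H} (hd : orderOf (d ^ n) = p) {i : ι} (hi : PFull H p (d i)) {j : ι}
    (hj : d j ^ n ≠ 1) : PFull H p (d j) := by
  obtain ⟨f, hf⟩ := Nat.exists_eq_add_one_of_ne_zero (exponent_factorization_pos hp hpH).ne'
  have hdvd : ∀ l, orderOf (d l) ∣ n * p := fun l => by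
    refine orderOf_dvd_of_pow_eq_one ?_
    have := congrFun (pow_orderOf_eq_one (d ^ n)) l
    rwa [hd, ← pow_mul] at this
  by_contra hnf
  rw [PFull, hf] at hnf hi
  have hfn : p ^ f ∣ n := Nat.dvd_of_mul_dvd_mul_right hp.pos (by
    rw [← pow_succ]
    exact hi.trans (hdvd i))
  exact hj (orderOf_dvd_iff_pow_eq_one.1 (dvd_of_dvd_mul_prime hp (hdvd j) hfn hnf))

lemma not_dvd_of_not_PFull {p : ℕ} (hp : p.Prime) (hpH : p ∣ Nat.card H)
    (h2 : ¬ p ^ 2 ∣ Monoid.exponent H) {x : H} (hx : ¬ PFull H p x) : ¬ p ∣ orderOf x := by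
  have hpos := exponent_factorization_pos hp hpH
  have hlt : (Monoid.exponent H).factorization p < 2 := by
    by_contra! h
    exact h2 ((pow_dvd_pow p h).trans (Nat.ordProj_dvd _ p))
  rwa [PFull, show (Monoid.exponent H).factorization p = 1 by omega, pow_one] at hx

open scoped Classical in
/-- For `d` running over the three rotations of `T` on the coordinates `σ m`, the support of a
power of `d` of prime order `p` meets these coordinates in `ν_p(T)` points. -/
lemma card_support_eq_nuP {ι : Type*} {p n : ℕ} (hp : p.Prime) (hpH : p ∣ Nat.card H)
    {T : H × H × H} (hT : nuP p T = 0 → ¬ p ^ 2 ∣ Monoid.exponent H ∨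
      (¬ p ∣ orderOf T.1 ∧ ¬ p ∣ orderOf T.2.1 ∧ ¬ p ∣ orderOf T.2.2))
    {U : ι → H × H × H} {σ : Fin 3 → ι} (hσ : ∀ m : Fin 3, U (σ m) = cycShift^[(m : ℕ)] T)
    {d : ι → H} (hdU : d = (piTriple U).1 ∨ d = (piTriple U).2.1 ∨ d = (piTriple U).2.2)
    (hd : orderOf (d ^ n) = p) :
    (Finset.univ.filter fun m => (d ^ n) (σ m) ≠ 1).card = nuP p T := by
  have hnu : (Finset.univ.filter fun m => PFull H p (d (σ m))).card = nuP p T := by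
    rw [Finset.card_filter, Fin.sum_univ_three, nuP]
    rcases hdU with rfl | rfl | rfl <;> simp [piTriple, hσ, cycShift] <;> ring
  rw [← hnu]
  congr 1
  refine Finset.filter_congr fun m _ => ⟨fun hm => ?_, fun hm => hm.pow_ne_one hp hd⟩
  by_cases h0 : nuP p T = 0
  · exfalso
    have hnd : ∀ x : H, x = T.1 ∨ x = T.2.1 ∨ x = T.2.2 → ¬ p ∣ orderOf x := by
      rcases hT h0 with h2 | h
      · have hfull : ¬ PFull H p T.1 ∧ ¬ PFull H p T.2.1 ∧ ¬ PFull H p T.2.2 := by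
          simpa [nuP, and_assoc] using h0
        rintro x (rfl | rfl | rfl)
        exacts [not_dvd_of_not_PFull hp hpH h2 hfull.1, not_dvd_of_not_PFull hp hpH h2 hfull.2.1,
          not_dvd_of_not_PFull hp hpH h2 hfull.2.2]
      · rintro x (rfl | rfl | rfl)
        exacts [h.1, h.2.1, h.2.2]
    have hmem : d (σ m) = T.1 ∨ d (σ m) = T.2.1 ∨ d (σ m) = T.2.2 := by
      rcases hdU with rfl | rfl | rfl <;> fin_cases m <;> simp [piTriple, hσ, cycShift]
    refine hm (orderOf_dvd_iff_pow_eq_one.1 (dvd_of_dvd_mul_prime hp (f := 0) ?_ (by simp)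
      (by simpa using hnd _ hmem)))
    refine orderOf_dvd_of_pow_eq_one ?_
    have := congrFun (pow_orderOf_eq_one (d ^ n)) (σ m)
    rwa [hd, ← pow_mul] at this
  · rw [← hnu, Finset.card_eq_zero, ← ne_eq, ← Finset.nonempty_iff_ne_empty] at h0
    obtain ⟨i, hi⟩ := h0
    exact PFull.of_pow_ne_one hp hpH hd (Finset.mem_filter.1 hi).2 hm

lemma mem_SigmaSet_iff {G : Type*} [Group G] [Finite G] {T : G × G × G} {x : G} :
    x ∈ SigmaSet T ↔ ∃ g d : G, ∃ n : ℕ, (d = T.1 ∨ d = T.2.1 ∨ d = T.2.2) ∧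
      d ^ n = g * x * g⁻¹ := by
  constructor
  · rintro ⟨g, (h | h) | h⟩
    · obtain ⟨n, hn⟩ := mem_powers_iff_mem_zpowers.2 h
      exact ⟨g, _, n, Or.inl rfl, hn⟩
    · obtain ⟨n, hn⟩ := mem_powers_iff_mem_zpowers.2 h
      exact ⟨g, _, n, Or.inr (Or.inl rfl), hn⟩
    · obtain ⟨n, hn⟩ := mem_powers_iff_mem_zpowers.2 h
      exact ⟨g, _, n, Or.inr (Or.inr rfl), hn⟩
  · rintro ⟨g, d, n, rfl | rfl | rfl, h⟩
    · exact ⟨g, Or.inl (Or.inl (h ▸ Subgroup.npow_mem_zpowers _ n))⟩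
    · exact ⟨g, Or.inl (Or.inr (h ▸ Subgroup.npow_mem_zpowers _ n))⟩
    · exact ⟨g, Or.inr (h ▸ Subgroup.npow_mem_zpowers _ n)⟩

lemma pow_mem_SigmaSet {G : Type*} [Group G] [Finite G] {T : G × G × G} {x : G}
    (hx : x ∈ SigmaSet T) (m : ℕ) : x ^ m ∈ SigmaSet T := by
  obtain ⟨g, d, n, hd, h⟩ := mem_SigmaSet_iff.1 hx
  exact mem_SigmaSet_iff.2 ⟨g, d, n * m, hd, by rw [pow_mul, h, conj_pow]⟩

open scoped Classical in
lemma card_support_of_mem_SigmaSet {ι : Type*} [Finite ι] {p : ℕ} (hp : p.Prime)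
    (hpH : p ∣ Nat.card H) {T : H × H × H}
    (hT : nuP p T = 0 → ¬ p ^ 2 ∣ Monoid.exponent H ∨
      (¬ p ∣ orderOf T.1 ∧ ¬ p ∣ orderOf T.2.1 ∧ ¬ p ∣ orderOf T.2.2))
    {U : ι → H × H × H} {σ : Fin 3 → ι} (hσ : ∀ m : Fin 3, U (σ m) = cycShift^[(m : ℕ)] T)
    {x : ι → H} (hx : x ∈ SigmaSet (piTriple U)) (hxp : orderOf x = p) :
    (Finset.univ.filter fun m => x (σ m) ≠ 1).card = nuP p T := by
  obtain ⟨g, d, n, hd, h⟩ := mem_SigmaSet_iff.1 hx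
  have hord : orderOf (d ^ n) = p := by
    rw [h, ← hxp]
    exact MulEquiv.orderOf_eq (MulAut.conj g) x
  rw [← card_support_eq_nuP hp hpH hT hσ hd hord, h]
  simp

lemma isHyperbolic_piTriple [IsSimpleGroup H] (hna : ¬ ∀ x y : H, x * y = y * x) {ι : Type*}
    [Finite ι] {T : H × H × H} (hT : IsGenTriple T) {U : ι → H × H × H} {σ : Fin 3 → ι}
    (hσ : ∀ m : Fin 3, U (σ m) = cycShift^[(m : ℕ)] T) : IsHyperbolic (piTriple U) := by
  have h0 : U (σ 0) = T := hσ 0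
  have h1 : U (σ 1) = (T.2.1, T.2.2, T.1) := hσ 1
  have h2 : U (σ 2) = (T.2.2, T.1, T.2.1) := hσ 2
  have key : ∀ d : ι → H, ∀ i, d i ^ orderOf d = 1 := fun d i =>
    congrFun (pow_orderOf_eq_one d) i
  refine IsHyperbolic.of_four_le ?_ ?_ ?_
  · refine hT.four_le_of_pow_eq_one hna (orderOf_pos _) ?_ ?_ ?_
    · simpa [piTriple, h0] using key (piTriple U).1 (σ 0)
    · simpa [piTriple, h1] using key (piTriple U).1 (σ 1)
    · simpa [piTriple, h2] using key (piTriple U).1 (σ 2)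
  · refine hT.four_le_of_pow_eq_one hna (orderOf_pos _) ?_ ?_ ?_
    · simpa [piTriple, h2] using key (piTriple U).2.1 (σ 2)
    · simpa [piTriple, h0] using key (piTriple U).2.1 (σ 0)
    · simpa [piTriple, h1] using key (piTriple U).2.1 (σ 1)
  · refine hT.four_le_of_pow_eq_one hna (orderOf_pos _) ?_ ?_ ?_
    · simpa [piTriple, h1] using key (piTriple U).2.2 (σ 1)
    · simpa [piTriple, h2] using key (piTriple U).2.2 (σ 2)
    · simpa [piTriple, h0] using key (piTriple U).2.2 (σ 0)

end Support

lemma IsGenTriple.cycShift {H : Type*} [Group H] {T : H × H × H} (hT : IsGenTriple T) :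
    IsGenTriple (cycShift T) := by
  refine ⟨?_, ?_⟩
  · show T.2.1 * T.2.2 * T.1 = 1
    have h : T.1 * (T.2.1 * T.2.2) = 1 := by rw [← mul_assoc]; exact hT.1
    exact mul_eq_one_comm.1 h
  · rw [← hT.2]
    congr 1
    ext x
    simp only [_root_.cycShift, Set.mem_insert_iff, Set.mem_singleton_iff]
    tauto

lemma IsGenTriple.iterate_cycShift {H : Type*} [Group H] {T : H × H × H} (hT : IsGenTriple T)
    (n : ℕ) : IsGenTriple (_root_.cycShift^[n] T) := by
  induction n with
  | zero => exact hT
  | succ n ih =>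
    rw [Function.iterate_succ_apply']
    exact ih.cycShift

/-- Lemma 4.2: if `H` has `t` ordered pairs of generating triples such that every prime
dividing `|H|` admits a strongly `p`-distinguishing pair among them, and for each `i = 1, 2`
the `3t` triples `T_{i,s}` together with their cyclic permutations are pairwise inequivalent,
then `Hᵏ` is a Beauville group for every `k` with `3t ≤ k` and `k·|Aut H| ≤ φ₂(H)`. -/
theorem beauville_of_strongly_distinguishing (H : Type*) [Group H] [Finite H]
    [IsSimpleGroup H] (hna : ¬ ∀ x y : H, x * y = y * x)
    (t : ℕ) (T₁ T₂ : Fin t → H × H × H)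
    (hgen : ∀ s, IsGenTriple (T₁ s) ∧ IsGenTriple (T₂ s))
    (h1 : ∀ p : ℕ, p.Prime → p ∣ Nat.card H →
      ∃ s, StronglyPDistinguishing p (T₁ s) (T₂ s))
    (h2 : ∀ T ∈ ({T₁, T₂} : Set (Fin t → H × H × H)), ∀ s s' : Fin t, ∀ m m' : Fin 3,
      (s, m) ≠ (s', m') →
        ¬ TripleEquiv (cycShift^[(m : ℕ)] (T s)) (cycShift^[(m' : ℕ)] (T s')))
    (k : ℕ) (hk : 3 * t ≤ k) (hk' : k * Nat.card (MulAut H) ≤ phi2 H) :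
    HasBeauvilleStructure (Fin k → H) := by

  obtain ⟨ι⟩ : Nonempty (Fin t × Fin 3 ↪ Fin k) :=
    Function.Embedding.nonempty_of_card_le (by simpa [mul_comm] using hk)
  have hext : ∀ T ∈ ({T₁, T₂} : Set (Fin t → H × H × H)), (∀ s, IsGenTriple (T s)) →
      ∃ U : Fin k → H × H × H, (∀ i, IsGenTriple (U i)) ∧
        (∀ i j, i ≠ j → ¬ TripleEquiv (U i) (U j)) ∧
        ∀ j, U (ι j) = cycShift^[(j.2 : ℕ)] (T j.1) := fun T hT hTg =>
    exists_extension_genTriple hk' ι (fun j => cycShift^[(j.2 : ℕ)] (T j.1))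
      (fun j => (hTg j.1).iterate_cycShift _) fun i j hij => h2 T hT i.1 j.1 i.2 j.2 hij
  obtain ⟨U₁, hU₁, hne₁, hι₁⟩ := hext T₁ (by simp) fun s => (hgen s).1
  obtain ⟨U₂, hU₂, hne₂, hι₂⟩ := hext T₂ (by simp) fun s => (hgen s).2
  obtain ⟨s₀⟩ : Nonempty (Fin t) := by
    obtain ⟨p, hp, hpH⟩ := Nat.exists_prime_and_dvd (Finite.one_lt_card (α := H)).ne'
    exact ⟨(h1 p hp hpH).choose⟩
  refine ⟨piTriple U₁, piTriple U₂, isGenTriple_piTriple hna U₁ hU₁ hne₁,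
    isHyperbolic_piTriple hna (hgen s₀).1 (σ := fun m => ι (s₀, m)) fun m => hι₁ (s₀, m),
    isGenTriple_piTriple hna U₂ hU₂ hne₂,
    isHyperbolic_piTriple hna (hgen s₀).2 (σ := fun m => ι (s₀, m)) fun m => hι₂ (s₀, m), ?_⟩
  refine Set.eq_singleton_iff_unique_mem.2 ⟨⟨?_, ?_⟩, fun x hx => ?_⟩
  · exact mem_SigmaSet_iff.2 ⟨1, _, 0, Or.inl rfl, by simp⟩
  · exact mem_SigmaSet_iff.2 ⟨1, _, 0, Or.inl rfl, by simp⟩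
  by_contra hx1
  obtain ⟨p, hp, hpx⟩ := Nat.exists_prime_and_dvd (mt orderOf_eq_one_iff.1 hx1)
  have hpH : p ∣ Nat.card H := by
    have := hpx.trans (orderOf_dvd_natCard x)
    rw [Nat.card_fun] at this
    exact hp.dvd_of_dvd_pow this
  have hord : orderOf (x ^ (orderOf x / p)) = p := orderOf_pow_orderOf_div (orderOf_pos x).ne' hpx
  obtain ⟨s, hs, hs'⟩ := h1 p hp hpH
  apply hs
  rw [← card_support_of_mem_SigmaSet hp hpH (hs' _ (by simp)) (σ := fun m => ι (s, m))
      (fun m => hι₁ (s, m)) (pow_mem_SigmaSet hx.1 _) hord,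
    ← card_support_of_mem_SigmaSet hp hpH (hs' _ (by simp)) (σ := fun m => ι (s, m))
      (fun m => hι₂ (s, m)) (pow_mem_SigmaSet hx.2 _) hord]
end

section
/- Let H be a non-abelian finite simple group which has r ≥ 2 pairwise inequivalent generating triples, all of the same type (l, m, n), where l, m and n are pairwise coprime. Then for every integer k with 2 ≤ k ≤ 6r, the direct power Hᵏ admits an unmixed Beauville structure. -/
open scoped MatrixGroups

/-- Two maps satisfying the relations of the rotation group of the icosahedron preserve a set of
at most twelve points containing a given point fixed by their composite. -/
theorem exists_finset_invariant_of_icosahedral {α : Type*} (X Y : α → α)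
    (hX : ∀ v, X (X v) = v) (hY : ∀ v, Y (Y (Y v)) = v)
    (hXY : ∀ v, X (Y (X (Y (X (Y (X (Y (X (Y v))))))))) = v) (v : α) (hv : X (Y v) = v) :
    ∃ S : Finset α, v ∈ S ∧ S.card ≤ 12 ∧ (∀ w ∈ S, X w ∈ S) ∧ ∀ w ∈ S, Y w ∈ S := by
  classical
  obtain ⟨v₁, h₁⟩ : ∃ w, w = X v := ⟨_, rfl⟩
  obtain ⟨v₂, h₂⟩ : ∃ w, w = Y v₁ := ⟨_, rfl⟩
  obtain ⟨v₃, h₃⟩ : ∃ w, w = X v₂ := ⟨_, rfl⟩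
  obtain ⟨v₄, h₄⟩ : ∃ w, w = Y v₃ := ⟨_, rfl⟩
  obtain ⟨v₅, h₅⟩ : ∃ w, w = X v₄ := ⟨_, rfl⟩
  obtain ⟨v₆, h₆⟩ : ∃ w, w = Y v₄ := ⟨_, rfl⟩
  obtain ⟨v₇, h₇⟩ : ∃ w, w = Y v₅ := ⟨_, rfl⟩
  obtain ⟨v₈, h₈⟩ : ∃ w, w = Y v₇ := ⟨_, rfl⟩
  obtain ⟨v₉, h₉⟩ : ∃ w, w = X v₈ := ⟨_, rfl⟩
  obtain ⟨v₁₀, h₁₀⟩ : ∃ w, w = Y v₉ := ⟨_, rfl⟩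
  obtain ⟨v₁₁, h₁₁⟩ : ∃ w, w = Y v₁₀ := ⟨_, rfl⟩
  have y₀ : Y v = v₁ := by rw [h₁, ← hX (Y v), hv]
  have x₁ : X v₁ = v := by rw [h₁, hX]
  have y₂ : Y v₂ = v := by rw [h₂, ← y₀, hY]
  have x₃ : X v₃ = v₂ := by rw [h₃, hX]
  have y₆ : Y v₆ = v₃ := by rw [h₆, h₄, hY]
  have x₅ : X v₅ = v₄ := by rw [h₅, hX]
  have y₈ : Y v₈ = v₅ := by rw [h₈, h₇, hY]
  have x₉ : X v₉ = v₈ := by rw [h₉, hX]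
  have y₁₁ : Y v₁₁ = v₉ := by rw [h₁₁, h₁₀, hY]
  have x₇ : X v₇ = v₆ := by
    simpa only [y₆, x₃, y₂, ← h₁, ← h₂, ← h₃, ← h₄, ← h₅, ← h₇] using hXY v₆
  have x₆ : X v₆ = v₇ := by rw [← x₇, hX]
  have x₁₀ : X v₁₀ = v₁₁ := by
    simpa only [y₁₁, x₉, y₈, x₅, ← h₆, x₆, ← h₈, ← h₉, ← h₁₀] using hXY v₁₁
  have x₁₁ : X v₁₁ = v₁₀ := by rw [← x₁₀, hX]
  refine ⟨{v, v₁, v₂, v₃, v₄, v₅, v₆, v₇, v₈, v₉, v₁₀, v₁₁}, by simp, ?_, ?_, ?_⟩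
  · refine (Finset.card_insert_le _ _).trans (Nat.succ_le_succ ?_)
    iterate 5 refine (Finset.card_insert_le _ _).trans (Nat.succ_le_succ ?_)
    exact Finset.card_le_six
  · simp [← h₁, x₁, ← h₃, x₃, ← h₅, x₅, x₆, x₇, ← h₉, x₉, x₁₀, x₁₁]
  · simp [y₀, ← h₂, y₂, ← h₄, ← h₆, y₆, ← h₇, ← h₈, y₈, ← h₁₀, ← h₁₁, y₁₁]

/-- A finite group generated by `x` and `y` with `x ^ 2 = y ^ 3 = (x * y) ^ 5 = 1` has order
at most `60`. -/
theorem card_le_of_icosahedral {G : Type*} [Group G] [Finite G] (x y : G)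
    (hx : x ^ 2 = 1) (hy : y ^ 3 = 1) (hxy : (x * y) ^ 5 = 1)
    (hgen : Subgroup.closure {x, y} = ⊤) : Nat.card G ≤ 60 := by
  classical
  set C := Subgroup.zpowers (x * y)
  obtain ⟨S, h1, hS, hSx, hSy⟩ := exists_finset_invariant_of_icosahedral
    (fun v : G ⧸ C => x • v) (fun v => y • v)
    (fun v => by simp only [← mul_smul, ← pow_two, hx, one_smul])
    (fun v => by
      simp only [← mul_smul]
      rw [show y * (y * y) = y ^ 3 by simp only [pow_succ, pow_zero, one_mul, mul_assoc], hy, one_smul])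
    (fun v => by
      simp only [← mul_smul]
      rw [show x * (y * (x * (y * (x * (y * (x * (y * (x * y)))))))) = (x * y) ^ 5 by
        simp only [pow_succ, pow_zero, one_mul, mul_assoc], hxy, one_smul])
    ((1 : G) : G ⧸ C)
    (by
      rw [← mul_smul, MulAction.Quotient.smul_coe, smul_eq_mul, mul_one, QuotientGroup.eq]
      exact C.mul_mem (C.inv_mem (Subgroup.mem_zpowers _)) C.one_mem)
  have hstab : ∀ g : G, ∀ v ∈ S, g • v ∈ S := by
    intro g
    have hg : g ∈ Subgroup.closure {x, y} := hgen ▸ Subgroup.mem_top g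
    rw [← Subgroup.mem_toSubmonoid, Subgroup.closure_toSubmonoid_of_finite] at hg
    induction hg using Submonoid.closure_induction with
    | mem g hg =>
      rcases hg with rfl | rfl
      exacts [hSx, hSy]
    | one => simp
    | mul a b _ _ ha hb => exact fun v hv => by rw [mul_smul]; exact ha _ (hb v hv)
  have huniv : (S : Set (G ⧸ C)) = Set.univ := by
    ext v
    obtain ⟨g, rfl⟩ := QuotientGroup.mk_surjective v
    simpa using hstab g _ h1
  have hindex : Nat.card (G ⧸ C) ≤ 12 := by
    rw [← Nat.card_univ (α := G ⧸ C), ← huniv]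
    simpa using hS
  have hC : Nat.card C ≤ 5 := by
    rw [Nat.card_zpowers]
    exact orderOf_le_of_pow_eq_one (by norm_num) hxy
  calc Nat.card G = Nat.card (G ⧸ C) * Nat.card C := Subgroup.card_eq_card_quotient_mul_card_subgroup C
    _ ≤ 12 * 5 := Nat.mul_le_mul hindex hC

/-- A subgroup of a power of a non-abelian finite simple group that projects onto every factor,
and no two of whose projections differ by an automorphism, is the whole power. -/
theorem Subgroup.eq_top_of_surjective_of_forall_not_automorphism {H : Type*} [Group H] [Finite H]
    [IsSimpleGroup H] (hna : ¬ ∀ x y : H, x * y = y * x) {ι : Type*} [Finite ι]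
    (K : Subgroup (ι → H)) (hsurj : ∀ i h, ∃ u ∈ K, u i = h)
    (hK : ∀ i j, i ≠ j → ¬ ∃ α : MulAut H, ∀ u ∈ K, α (u j) = u i) : K = ⊤ := by
  classical
  have := Fintype.ofFinite ι
  let N (i : ι) (S : Finset ι) : Subgroup H :=
    (K ⊓ ⨅ j ∈ S, (Pi.evalMonoidHom (fun _ : ι => H) j).ker).map (Pi.evalMonoidHom (fun _ => H) i)
  have mem_N (i S h) : h ∈ N i S ↔ ∃ u ∈ K, (∀ j ∈ S, u j = 1) ∧ u i = h := by
    simp [N, Subgroup.mem_map, Subgroup.mem_inf, Subgroup.mem_iInf, MonoidHom.mem_ker, and_assoc]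
  have N_normal (i S) : (N i S).Normal := by
    refine ⟨fun h hh g => ?_⟩
    rw [mem_N] at hh ⊢
    obtain ⟨u, hu, hu1, rfl⟩ := hh
    obtain ⟨w, hw, rfl⟩ := hsurj i g
    exact ⟨w * u * w⁻¹, K.mul_mem (K.mul_mem hw hu) (K.inv_mem hw),
      fun j hj => by simp [hu1 j hj], by simp⟩
  have N_pair (i j) (hij : i ≠ j) : N i {j} = ⊤ := by
    refine (N_normal i {j}).eq_bot_or_eq_top.resolve_left fun hbot => hK i j hij ?_
    have key : ∀ u ∈ K, u j = 1 → u i = 1 := fun u hu huj => by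
      rw [← Subgroup.mem_bot, ← hbot, mem_N]
      exact ⟨u, hu, by simpa using huj, rfl⟩
    have uniq : ∀ u ∈ K, ∀ w ∈ K, u j = w j → u i = w i := fun u hu w hw huw => by
      have := key (u * w⁻¹) (K.mul_mem hu (K.inv_mem hw)) (by simp [huw])
      exact mul_inv_eq_one.1 (by simpa using this)
    choose s hs hsj using hsurj j
    let φ : H →* H := MonoidHom.mk' (fun h => s h i) fun a b => by
      rw [← Pi.mul_apply]
      exact uniq _ (hs _) _ (K.mul_mem (hs a) (hs b)) (by simp [hsj])
    have hφ : ∀ u ∈ K, φ (u j) = u i := fun u hu => uniq _ (hs _) _ hu (hsj _)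
    have hφs : Function.Surjective φ := fun h => by
      obtain ⟨u, hu, rfl⟩ := hsurj i h
      exact ⟨u j, hφ u hu⟩
    exact ⟨MulEquiv.ofBijective φ ⟨Finite.injective_iff_surjective.2 hφs, hφs⟩, hφ⟩
  have N_top (i : ι) (S : Finset ι) (hi : i ∉ S) : N i S = ⊤ := by
    induction S using Finset.induction_on with
    | empty => exact (Subgroup.eq_top_iff' _).2 fun h => by simpa [mem_N] using hsurj i h
    | insert j S hj ih =>
      rw [Finset.mem_insert, not_or] at hi
      refine (N_normal i _).eq_bot_or_eq_top.resolve_left fun hbot => hna fun x y => ?_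
      obtain ⟨u, hu, hu1, rfl⟩ := (mem_N i S x).1 (ih hi.2 ▸ Subgroup.mem_top x)
      obtain ⟨w, hw, hw1, rfl⟩ := (mem_N i {j} y).1 (N_pair i j hi.1 ▸ Subgroup.mem_top y)
      rw [← mul_inv_eq_one, mul_inv_rev, ← mul_assoc, ← Subgroup.mem_bot, ← hbot, mem_N]
      refine ⟨u * w * u⁻¹ * w⁻¹, ?_, ?_, rfl⟩
      · exact K.mul_mem (K.mul_mem (K.mul_mem hu hw) (K.inv_mem hu)) (K.inv_mem hw)
      · intro q hq
        rcases Finset.mem_insert.1 hq with rfl | hq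
        · simp [hw1 q (by simp)]
        · simp [hu1 q hq]
  rw [Subgroup.eq_top_iff']
  refine fun u => Subgroup.pi_mem_of_mulSingle_mem u fun i => ?_
  obtain ⟨w, hw, hw1, hwi⟩ := (mem_N i (Finset.univ.erase i) (u i)).1
    (N_top i _ (Finset.notMem_erase i _) ▸ Subgroup.mem_top _)
  convert hw
  ext j
  by_cases hj : j = i
  · subst hj; rw [Pi.mulSingle_eq_same, hwi]
  · simp [hj, hw1 j (by simp [hj])]

/-- For `2 ≤ k ≤ 6 * r` and `2 ≤ r` there are `k` pairs (permutation of three letters, index below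
`r`) and a rearrangement of all such pairs for which no set of coordinates in which a given letter
has a given position is also of this form after the rearrangement. -/
theorem exists_injective_perm_forall_letter (r k : ℕ) (hr : 2 ≤ r) (hk2 : 2 ≤ k)
    (hk6 : k ≤ 6 * r) :
    ∃ (f : Fin k → Equiv.Perm (Fin 3) × Fin r) (τ : Equiv.Perm (Equiv.Perm (Fin 3) × Fin r)),
      Function.Injective f ∧ ∀ (t : Fin 3) (i : Fin k), ∃ j,
        ¬ ((f i).1⁻¹ t = (f j).1⁻¹ t ↔ (τ (f i)).1⁻¹ t = (τ (f j)).1⁻¹ t) := by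
  classical
  let u (t : Fin 3) (x : Equiv.Perm (Fin 3) × Fin r) : Fin 3 := x.1⁻¹ t
  suffices h : ∃ (S : Finset (Equiv.Perm (Fin 3) × Fin r))
      (τ : Equiv.Perm (Equiv.Perm (Fin 3) × Fin r)), S.card = k ∧
      ∀ t, ∀ x ∈ S, ∃ y ∈ S, ¬ (u t x = u t y ↔ u t (τ x) = u t (τ y)) by
    obtain ⟨S, τ, hS, h⟩ := h
    refine ⟨fun i => (S.equivFinOfCardEq hS).symm i, τ,
      Subtype.val_injective.comp (Equiv.injective _), fun t i => ?_⟩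
    obtain ⟨y, hy, hxy⟩ := h t _ ((S.equivFinOfCardEq hS).symm i).2
    exact ⟨S.equivFinOfCardEq hS ⟨y, hy⟩, by simpa [u] using hxy⟩
  let z : Fin r := ⟨0, by omega⟩
  let z' : Fin r := ⟨1, by omega⟩
  have hz : z ≠ z' := by simp [z, z']
  let c : Equiv.Perm (Fin 3) := finRotate 3
  have hc1 : c ≠ 1 := by decide
  have hc2 : c ≠ c⁻¹ := by decide
  have hc3 : c⁻¹ ≠ 1 := by decide
  have hu : ∀ t, (c⁻¹ t ≠ t ∧ c t ≠ t ∧ c t ≠ c⁻¹ t) ∧ ∀ p, p = t ∨ p = c t ∨ p = c⁻¹ t := by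
    decide
  have u1 : ∀ t q, u t (1, q) = t := fun _ _ => rfl
  have u2 : ∀ t q, u t (c, q) = c⁻¹ t := fun _ _ => rfl
  have u3 : ∀ t q, u t (c⁻¹, q) = c t := fun _ _ => rfl
  clear_value u c z z'
  rcases le_or_gt k 4 with hk | hk
  · obtain ⟨S, hS1, hS2, hS⟩ := Finset.exists_subsuperset_card_eq
      (s := {(1, z), (1, z')}) (t := {(1, z), (1, z'), (c, z), (c, z')}) (n := k)
      (by intro; simp; tauto) (Finset.card_le_two.trans hk2) (by
        simpa [Finset.card_insert_of_notMem, hz, hc1, hc1.symm] using hk)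
    have m1 : (1, z) ∈ S := hS1 (by simp)
    have m2 : (1, z') ∈ S := hS1 (by simp)
    refine ⟨S, Equiv.swap (1, z) (c, z), hS, fun t x hx => ?_⟩
    have t1 : Equiv.swap (1, z) (c, z) (1, z') = (1, z') :=
      Equiv.swap_apply_of_ne_of_ne (by simp [hz.symm]) (by simp [hz.symm])
    have t2 : Equiv.swap (1, z) (c, z) (c, z') = (c, z') :=
      Equiv.swap_apply_of_ne_of_ne (by simp [hz.symm]) (by simp [hz.symm])
    have := (hu t).1
    have hx' := hS2 hx
    simp only [Finset.mem_insert, Finset.mem_singleton] at hx'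
    rcases hx' with rfl | rfl | rfl | rfl
    · exact ⟨_, m2, by grind⟩
    · exact ⟨_, m1, by grind⟩
    · exact ⟨_, m2, by grind⟩
    · exact ⟨_, m1, by grind⟩
  · obtain ⟨S, hS1, -, hS⟩ := Finset.exists_subsuperset_card_eq
      (s := {(1, z), (1, z'), (c, z), (c, z'), (c⁻¹, z)}) (t := Finset.univ) (n := k)
      (Finset.subset_univ _) (Finset.card_le_five.trans hk) (by
        simpa [Fintype.card_perm, Nat.factorial] using hk6)
    have m1 : (1, z) ∈ S := hS1 (by simp)
    have m2 : (1, z') ∈ S := hS1 (by simp)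
    have m3 : (c, z) ∈ S := hS1 (by simp)
    have m4 : (c, z') ∈ S := hS1 (by simp)
    have m5 : (c⁻¹, z) ∈ S := hS1 (by simp)
    let τ : Equiv.Perm (Equiv.Perm (Fin 3) × Fin r) :=
      Equiv.swap (1, z) (c, z) * Equiv.swap (c, z) (c⁻¹, z)
    have τ1 : τ (1, z) = (c, z) := by
      simp only [τ, Equiv.Perm.mul_apply, Equiv.swap_apply_def]
      grind
    have τ2 : τ (c, z) = (c⁻¹, z) := by
      simp only [τ, Equiv.Perm.mul_apply, Equiv.swap_apply_def]
      grind
    have τ3 : τ (c⁻¹, z) = (1, z) := by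
      simp only [τ, Equiv.Perm.mul_apply, Equiv.swap_apply_def]
      grind
    have τ4 : ∀ x, x ≠ (1, z) → x ≠ (c, z) → x ≠ (c⁻¹, z) → τ x = x := by
      intro x h1 h2 h3
      simp [τ, Equiv.swap_apply_def, h1, h2, h3]
    have τ5 : ∀ p, τ (p, z') = (p, z') := fun p =>
      τ4 _ (by simp [hz.symm]) (by simp [hz.symm]) (by simp [hz.symm])
    clear_value τ
    refine ⟨S, τ, hS, fun t x hx => ?_⟩
    have := (hu t).1
    by_cases h1 : x = (1, z)
    · subst h1; exact ⟨_, m2, by grind⟩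
    by_cases h2 : x = (c, z)
    · subst h2; exact ⟨_, m4, by grind⟩
    by_cases h3 : x = (c⁻¹, z)
    · subst h3; exact ⟨_, m2, by grind⟩
    have hx' := τ4 x h1 h2 h3
    rcases (hu t).2 (u t x) with h | h | h
    · exact ⟨_, m1, by grind⟩
    · exact ⟨_, m5, by grind⟩
    · exact ⟨_, m3, by grind⟩

/-- The three entries of a triple, as a function. -/
def tripleEntry {G : Type*} (T : G × G × G) : Fin 3 → G := ![T.1, T.2.1, T.2.2]

/-- From a family `T` of triples in `H` and a choice `f` of a permutation of the entries and of a
member of `T` for every coordinate, the `p`-th entry of the resulting triple in the power of `H`: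
in each coordinate, the chosen triple is permuted, and its entries are inverted if the permutation
is odd. -/
def permutedEntry {H ι κ : Type*} [Group H] (T : κ → H × H × H)
    (f : ι → Equiv.Perm (Fin 3) × κ) (p : Fin 3) : ι → H :=
  fun i => tripleEntry (T (f i).2) ((f i).1 p) ^ (Equiv.Perm.sign (f i).1 : ℤ)

theorem zpow_units_zpow_units {G : Type*} [Group G] (g : G) (ε : ℤˣ) :
    (g ^ (ε : ℤ)) ^ (ε : ℤ) = g := by
  rw [← zpow_mul, ← Units.val_mul, Int.units_mul_self, Units.val_one, zpow_one]

theorem orderOf_zpow_units {G : Type*} [Group G] (g : G) (ε : ℤˣ) :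
    orderOf (g ^ (ε : ℤ)) = orderOf g := by
  rcases Int.units_eq_one_or ε with rfl | rfl <;> simp

theorem mul_mul_permuted_eq_one {H : Type*} [Group H] (t : Fin 3 → H) (ht : t 0 * t 1 * t 2 = 1)
    (s : Equiv.Perm (Fin 3)) :
    t (s 0) ^ (Equiv.Perm.sign s : ℤ) * t (s 1) ^ (Equiv.Perm.sign s : ℤ) *
      t (s 2) ^ (Equiv.Perm.sign s : ℤ) = 1 := by
  have hs : ∀ s : Equiv.Perm (Fin 3),
      (s 0 = 0 ∧ s 1 = 1 ∧ s 2 = 2 ∧ Equiv.Perm.sign s = 1) ∨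
      (s 0 = 1 ∧ s 1 = 2 ∧ s 2 = 0 ∧ Equiv.Perm.sign s = 1) ∨
      (s 0 = 2 ∧ s 1 = 0 ∧ s 2 = 1 ∧ Equiv.Perm.sign s = 1) ∨
      (s 0 = 2 ∧ s 1 = 1 ∧ s 2 = 0 ∧ Equiv.Perm.sign s = -1) ∨
      (s 0 = 1 ∧ s 1 = 0 ∧ s 2 = 2 ∧ Equiv.Perm.sign s = -1) ∨
      (s 0 = 0 ∧ s 1 = 2 ∧ s 2 = 1 ∧ Equiv.Perm.sign s = -1) := by
    decide
  have h2 : t 2 = (t 0 * t 1)⁻¹ := eq_inv_of_mul_eq_one_right ht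
  rcases hs s with ⟨h₀, h₁, h₂, h⟩ | ⟨h₀, h₁, h₂, h⟩ | ⟨h₀, h₁, h₂, h⟩ | ⟨h₀, h₁, h₂, h⟩ |
    ⟨h₀, h₁, h₂, h⟩ | ⟨h₀, h₁, h₂, h⟩ <;> simp [h₀, h₁, h₂, h, h2, mul_assoc]

theorem orderOf_permutedEntry_apply {H ι κ : Type*} [Group H] {T : κ → H × H × H} {d : Fin 3 → ℕ}
    (hd : ∀ j q, orderOf (tripleEntry (T j) q) = d q) (f : ι → Equiv.Perm (Fin 3) × κ)
    (p : Fin 3) (i : ι) : orderOf (permutedEntry T f p i) = d ((f i).1 p) := by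
  rw [permutedEntry, orderOf_zpow_units, hd]

theorem isGenTriple_permutedEntry {H ι κ : Type*} [Group H] [Finite H] [IsSimpleGroup H]
    (hna : ¬ ∀ x y : H, x * y = y * x) [Finite ι] {T : κ → H × H × H} {d : Fin 3 → ℕ}
    (hd : ∀ j q, orderOf (tripleEntry (T j) q) = d q) (hdinj : Function.Injective d)
    (hgen : ∀ j, IsGenTriple (T j)) (hineq : ∀ j j', j ≠ j' → ¬ TripleEquiv (T j) (T j'))
    (f : ι → Equiv.Perm (Fin 3) × κ) (hf : Function.Injective f) :
    IsGenTriple (permutedEntry T f 0, permutedEntry T f 1, permutedEntry T f 2) := by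
  refine ⟨funext fun i => mul_mul_permuted_eq_one _ (hgen (f i).2).1 (f i).1, ?_⟩
  dsimp only
  set K := Subgroup.closure {permutedEntry T f 0, permutedEntry T f 1, permutedEntry T f 2}
  have hmem : ∀ p, permutedEntry T f p ∈ K := fun p =>
    Subgroup.subset_closure (by fin_cases p <;> simp)
  refine K.eq_top_of_surjective_of_forall_not_automorphism hna (fun i h => ?_) fun i j hij => ?_
  · have hle : Subgroup.closure {(T (f i).2).1, (T (f i).2).2.1, (T (f i).2).2.2} ≤
        K.map (Pi.evalMonoidHom (fun _ => H) i) := by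
      have key : ∀ q, tripleEntry (T (f i).2) q ∈ K.map (Pi.evalMonoidHom (fun _ => H) i) :=
        fun q => ⟨permutedEntry T f ((f i).1⁻¹ q) ^ (Equiv.Perm.sign (f i).1 : ℤ),
          K.zpow_mem (hmem _) _, by simp [permutedEntry, zpow_units_zpow_units]⟩
      rw [Subgroup.closure_le]
      rintro x (rfl | rfl | rfl)
      exacts [key 0, key 1, key 2]
    rw [(hgen _).2] at hle
    exact hle (Subgroup.mem_top h)
  · rintro ⟨α, hα⟩
    have hs : (f i).1 = (f j).1 := Equiv.ext fun p => hdinj <| by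
      rw [← orderOf_permutedEntry_apply hd, ← orderOf_permutedEntry_apply hd, ← hα _ (hmem p)]
      exact orderOf_injective α.toMonoidHom α.injective _
    have key : ∀ q, α (tripleEntry (T (f j).2) q) = tripleEntry (T (f i).2) q := fun q => by
      have h := congrArg (· ^ (Equiv.Perm.sign (f j).1 : ℤ)) (hα _ (hmem ((f j).1⁻¹ q)))
      simpa [permutedEntry, hs, zpow_units_zpow_units] using h
    refine hineq (f j).2 (f i).2 (fun h => hij (hf (Prod.ext hs h.symm))) ⟨α, key 0, key 1, key 2⟩

theorem one_mem_sigmaSet {G : Type*} [Group G] (T : G × G × G) : (1 : G) ∈ SigmaSet T :=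
  ⟨1, by simp⟩

theorem exists_conj_eq_zpow_of_mem_sigmaSet {G : Type*} [Group G] {T : G × G × G} {x : G}
    (hx : x ∈ SigmaSet T) : ∃ (p : Fin 3) (g : G) (a : ℤ), g * x * g⁻¹ = tripleEntry T p ^ a := by
  obtain ⟨g, (⟨a, ha⟩ | ⟨a, ha⟩) | ⟨a, ha⟩⟩ := hx
  exacts [⟨0, g, a, ha.symm⟩, ⟨1, g, a, ha.symm⟩, ⟨2, g, a, ha.symm⟩]

theorem sigmaSet_inter_permutedEntry {H ι κ : Type*} [Group H] {T : κ → H × H × H} {d : Fin 3 → ℕ}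
    (hd : ∀ j q, orderOf (tripleEntry (T j) q) = d q)
    (hdcop : ∀ q q', q ≠ q' → (d q).Coprime (d q')) (f f' : ι → Equiv.Perm (Fin 3) × κ)
    (hff : ∀ (t : Fin 3) (i : ι), ∃ j,
      ¬ ((f i).1⁻¹ t = (f j).1⁻¹ t ↔ (f' i).1⁻¹ t = (f' j).1⁻¹ t)) :
    SigmaSet (permutedEntry T f 0, permutedEntry T f 1, permutedEntry T f 2) ∩
      SigmaSet (permutedEntry T f' 0, permutedEntry T f' 1, permutedEntry T f' 2) = {1} := by
  have hentry : ∀ f : ι → Equiv.Perm (Fin 3) × κ, tripleEntry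
      (permutedEntry T f 0, permutedEntry T f 1, permutedEntry T f 2) = permutedEntry T f := by
    intro f
    ext p : 1
    fin_cases p <;> rfl
  refine Set.eq_singleton_iff_unique_mem.2 ⟨⟨one_mem_sigmaSet _, one_mem_sigmaSet _⟩, ?_⟩
  rintro x ⟨hx, hx'⟩
  obtain ⟨p, g, a, hp⟩ := exists_conj_eq_zpow_of_mem_sigmaSet hx
  obtain ⟨p', g', a', hp'⟩ := exists_conj_eq_zpow_of_mem_sigmaSet hx'
  rw [hentry] at hp hp'
  have hone : ∀ (f : ι → Equiv.Perm (Fin 3) × κ) (p : Fin 3) (g : ι → H) (a : ℤ),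
      g * x * g⁻¹ = permutedEntry T f p ^ a → ∀ i, x i = 1 ↔ (d ((f i).1 p) : ℤ) ∣ a := by
    intro f p g a h i
    rw [← orderOf_permutedEntry_apply hd, orderOf_dvd_iff_zpow_eq_one, ← Pi.pow_apply, ← h]
    simp
  have hdvd : ∀ (f : ι → Equiv.Perm (Fin 3) × κ) (p : Fin 3) (g : ι → H) (a : ℤ),
      g * x * g⁻¹ = permutedEntry T f p ^ a → ∀ i, orderOf (x i) ∣ d ((f i).1 p) := by
    intro f p g a h i
    rw [← orderOf_permutedEntry_apply hd]
    have hconj : g i * x i * (g i)⁻¹ = permutedEntry T f p i ^ a := congrFun h i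
    have : orderOf (x i) = orderOf (g i * x i * (g i)⁻¹) :=
      (orderOf_injective (MulAut.conj (g i)).toMonoidHom (MulAut.conj (g i)).injective _).symm
    rw [this, hconj]
    exact orderOf_dvd_of_mem_zpowers (Subgroup.zpow_mem_zpowers _ _)
  have heq : ∀ i, (f i).1 p ≠ (f' i).1 p' → x i = 1 := fun i hi =>
    orderOf_eq_one_iff.1 <|
      Nat.eq_one_of_dvd_coprimes (hdcop _ _ hi) (hdvd _ _ _ _ hp i) (hdvd _ _ _ _ hp' i)
  ext i
  by_contra hxi
  have hi : (f i).1 p = (f' i).1 p' := by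
    by_contra hi
    exact hxi (heq i hi)
  obtain ⟨j, hj⟩ := hff ((f i).1 p) i
  have h₁ : (f i).1⁻¹ ((f i).1 p) = p := by simp
  have h₂ : (f' i).1⁻¹ ((f i).1 p) = p' := by simp [hi]
  rw [h₁, h₂, Equiv.Perm.eq_inv_iff_eq, Equiv.Perm.eq_inv_iff_eq] at hj
  by_cases hjp : (f j).1 p = (f i).1 p
  · have hxj := heq j fun h => hj ⟨fun _ => h ▸ hjp, fun _ => hjp⟩
    rw [hone _ _ _ _ hp, hjp, ← hone _ _ _ _ hp] at hxj
    exact hxi hxj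
  · have hjp' : (f' j).1 p' = (f i).1 p := by
      by_contra h
      exact hj ⟨fun h' => absurd h' hjp, fun h' => absurd h' h⟩
    have hxj := heq j fun h => hjp (h.trans hjp')
    rw [hone _ _ _ _ hp', hjp', hi, ← hone _ _ _ _ hp'] at hxj
    exact hxi hxj

/-- The reciprocals of three pairwise coprime integers greater than `1` sum to less than `1`, unless
these integers are `2`, `3` and `5`. -/
theorem sum_inv_lt_one_or_exists_perm (d : Fin 3 → ℕ) (hd1 : ∀ q, d q ≠ 1) (hd0 : ∀ q, d q ≠ 0)
    (hdcop : ∀ q q', q ≠ q' → (d q).Coprime (d q')) :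
    ∑ q, (d q : ℚ)⁻¹ < 1 ∨ ∃ s : Equiv.Perm (Fin 3), d (s 0) = 2 ∧ d (s 1) = 3 ∧ d (s 2) = 5 := by
  set s := Tuple.sort d
  have hmono : Monotone (d ∘ s) := Tuple.monotone_sort d
  have hne : ∀ q q', q ≠ q' → d (s q) ≠ d (s q') := fun q q' hqq h => by
    have := hdcop (s q) (s q') (s.injective.ne hqq)
    rw [h, Nat.coprime_self] at this
    exact hd1 _ this
  have h01 : d (s 0) < d (s 1) := lt_of_le_of_ne (hmono (by decide)) (hne _ _ (by decide))
  have h12 : d (s 1) < d (s 2) := lt_of_le_of_ne (hmono (by decide)) (hne _ _ (by decide))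
  have h0 : 2 ≤ d (s 0) := by have := hd0 (s 0); have := hd1 (s 0); omega
  have h02 := hdcop (s 0) (s 2) (s.injective.ne (by decide))
  rw [← Equiv.sum_comp s, Fin.sum_univ_three]
  refine or_iff_not_imp_left.2 fun hsum => ⟨s, ?_⟩
  clear_value s
  generalize d (s 0) = a at *
  generalize d (s 1) = b at *
  generalize d (s 2) = c at *
  have bound : ∀ {u v : ℕ}, 0 < u → u ≤ v → (v : ℚ)⁻¹ ≤ (u : ℚ)⁻¹ := fun hu huv =>
    inv_anti₀ (by exact_mod_cast hu) (by exact_mod_cast huv)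
  have ha : a = 2 := by
    by_contra ha
    have := bound (u := 3) (v := a) (by norm_num) (by omega)
    have := bound (u := 4) (v := b) (by norm_num) (by omega)
    have := bound (u := 5) (v := c) (by norm_num) (by omega)
    norm_num at *
    linarith
  subst ha
  have hb : b = 3 := by
    by_contra hb
    have := bound (u := 4) (v := b) (by norm_num) (by omega)
    have := bound (u := 5) (v := c) (by norm_num) (by omega)
    norm_num at *
    linarith
  subst hb
  have hc : c < 7 := by
    by_contra hc
    have := bound (u := 7) (v := c) (by norm_num) (by omega)
    norm_num at *
    linarith
  interval_cases c
  · norm_num at h02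
  · simp
  · norm_num at h02

theorem orderOf_entry_ne_one {G : Type*} [Group G] [Nontrivial G] {T : G × G × G}
    (hT : IsGenTriple T)
    (hcop : ∀ q q', q ≠ q' → (orderOf (tripleEntry T q)).Coprime (orderOf (tripleEntry T q')))
    (q : Fin 3) : orderOf (tripleEntry T q) ≠ 1 := by
  obtain ⟨a, b, c⟩ := T
  obtain ⟨habc, hgen⟩ := hT
  have h01 : (orderOf a).Coprime (orderOf b) := hcop 0 1 (by decide)
  have h12 : (orderOf b).Coprime (orderOf c) := hcop 1 2 (by decide)
  have h02 : (orderOf a).Coprime (orderOf c) := hcop 0 2 (by decide)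
  dsimp only at habc hgen
  have hne : ¬ (a = 1 ∧ b = 1 ∧ c = 1) := by
    rintro ⟨rfl, rfl, rfl⟩
    rw [Set.pair_eq_singleton, Set.pair_eq_singleton, Subgroup.closure_singleton_one] at hgen
    exact bot_ne_top hgen
  intro h
  rw [orderOf_eq_one_iff] at h
  refine hne ?_
  fin_cases q
  · obtain rfl : a = 1 := h
    obtain rfl : b = c⁻¹ := by rw [one_mul] at habc; exact eq_inv_of_mul_eq_one_left habc
    simpa using h12
  · obtain rfl : b = 1 := h
    obtain rfl : a = c⁻¹ := by rw [mul_one] at habc; exact eq_inv_of_mul_eq_one_left habc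
    simpa using h02
  · obtain rfl : c = 1 := h
    obtain rfl : a = b⁻¹ := by rw [mul_one] at habc; exact eq_inv_of_mul_eq_one_left habc
    simpa using h01

theorem isHyperbolic_permutedEntry {H ι κ : Type*} [Group H] [Finite H] [Finite ι] [Nonempty ι]
    {T : κ → H × H × H} {d : Fin 3 → ℕ} (hd : ∀ j q, orderOf (tripleEntry (T j) q) = d q)
    (hsum : ∑ q, (d q : ℚ)⁻¹ < 1) (f : ι → Equiv.Perm (Fin 3) × κ) :
    IsHyperbolic (permutedEntry T f 0, permutedEntry T f 1, permutedEntry T f 2) := by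
  obtain ⟨i⟩ := ‹Nonempty ι›
  have key : ∀ p, (orderOf (permutedEntry T f p) : ℚ)⁻¹ ≤ (d ((f i).1 p) : ℚ)⁻¹ := fun p => by
    rw [← orderOf_permutedEntry_apply hd f p i]
    refine inv_anti₀ (by exact_mod_cast orderOf_pos _) ?_
    exact_mod_cast Nat.le_of_dvd (orderOf_pos _)
      (orderOf_map_dvd (Pi.evalMonoidHom (fun _ : ι => H) i) (permutedEntry T f p))
  rw [← Equiv.sum_comp (f i).1, Fin.sum_univ_three] at hsum
  exact lt_of_le_of_lt (add_le_add (add_le_add (key 0) (key 1)) (key 2)) hsum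

/-- Up to automorphisms, a non-abelian finite simple group has at most one generating triple with
entries of orders `2`, `3` and `5`. -/
theorem not_type_two_three_five {H : Type*} [Group H] [Finite H] [IsSimpleGroup H]
    (hna : ¬ ∀ x y : H, x * y = y * x) {r : ℕ} (hr : 2 ≤ r) {T : Fin r → H × H × H}
    {d : Fin 3 → ℕ} (hd : ∀ j q, orderOf (tripleEntry (T j) q) = d q)
    (hdinj : Function.Injective d) (hgen : ∀ j, IsGenTriple (T j))
    (hineq : ∀ j j', j ≠ j' → ¬ TripleEquiv (T j) (T j')) (s : Equiv.Perm (Fin 3)) :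
    ¬ (d (s 0) = 2 ∧ d (s 1) = 3 ∧ d (s 2) = 5) := by
  rintro ⟨h2, h3, h5⟩
  let f : Fin 2 → Equiv.Perm (Fin 3) × Fin r := fun i => (s, Fin.castLE hr i)
  have hf : Function.Injective f := fun i j h => Fin.castLE_injective hr (Prod.ext_iff.1 h).2
  obtain ⟨hprod, htop⟩ := isGenTriple_permutedEntry hna hd hdinj hgen hineq f hf
  dsimp only at hprod htop
  have hpow : ∀ p, permutedEntry T f p ^ d (s p) = 1 := fun p => funext fun i => by
    rw [Pi.pow_apply, ← orderOf_permutedEntry_apply hd f p i, pow_orderOf_eq_one, Pi.one_apply]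
  have hz := eq_inv_of_mul_eq_one_right hprod
  have hcard : Nat.card (Fin 2 → H) ≤ 60 := by
    refine card_le_of_icosahedral (permutedEntry T f 0) (permutedEntry T f 1)
      (by simpa only [h2] using hpow 0) (by simpa only [h3] using hpow 1) ?_ ?_
    · rw [← inv_eq_one, ← inv_pow, ← hz, ← h5]
      exact hpow 2
    · rw [eq_top_iff, ← htop, Subgroup.closure_le]
      have h0 := Subgroup.subset_closure (Set.mem_insert (permutedEntry T f 0) {permutedEntry T f 1})
      have h1 := Subgroup.subset_closure
        (Set.mem_insert_of_mem (permutedEntry T f 0) (Set.mem_singleton (permutedEntry T f 1)))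
      rintro x (rfl | rfl | rfl)
      · exact h0
      · exact h1
      · rw [hz]
        exact Subgroup.inv_mem _ (Subgroup.mul_mem _ h0 h1)
  have hdvd : ∀ q, d q ∣ Nat.card H := fun q => hd ⟨0, by omega⟩ q ▸ orderOf_dvd_natCard _
  have h30 : 30 ∣ Nat.card H := by
    have := h2 ▸ hdvd (s 0)
    have := h3 ▸ hdvd (s 1)
    have := h5 ▸ hdvd (s 2)
    omega
  have hle := Nat.le_of_dvd Nat.card_pos h30
  rw [Nat.card_fun, Nat.card_fin] at hcard
  nlinarith

/-- Lemma 4.4: if a non-abelian finite simple group `H` has `r ≥ 2` pairwise inequivalent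
generating triples of common type `(l, m, n)` with `l, m, n` pairwise coprime, then `Hᵏ`
admits an unmixed Beauville structure for every `k` with `2 ≤ k ≤ 6r`. -/
theorem beauville_of_coprime_type_triples (H : Type*) [Group H] [Finite H]
    [IsSimpleGroup H] (hna : ¬ ∀ x y : H, x * y = y * x)
    (r : ℕ) (hr : 2 ≤ r) (l m n : ℕ)
    (hlm : Nat.Coprime l m) (hmn : Nat.Coprime m n) (hln : Nat.Coprime l n)
    (T : Fin r → H × H × H)
    (hgen : ∀ j, IsGenTriple (T j))
    (htype : ∀ j, orderOf (T j).1 = l ∧ orderOf (T j).2.1 = m ∧ orderOf (T j).2.2 = n)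
    (hineq : ∀ j j', j ≠ j' → ¬ TripleEquiv (T j) (T j'))
    (k : ℕ) (hk2 : 2 ≤ k) (hk6 : k ≤ 6 * r) :
    HasBeauvilleStructure (Fin k → H) := by
  have hd : ∀ j q, orderOf (tripleEntry (T j) q) = ![l, m, n] q := fun j q => by
    fin_cases q
    exacts [(htype j).1, (htype j).2.1, (htype j).2.2]
  have hdcop : ∀ q q', q ≠ q' → (![l, m, n] q).Coprime (![l, m, n] q') := by
    simpa [Fin.forall_fin_succ] using
      ⟨⟨hlm, hln⟩, ⟨hlm.symm, hmn⟩, hln.symm, hmn.symm⟩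
  generalize ![l, m, n] = d at hd hdcop
  have j₀ : Fin r := ⟨0, by omega⟩
  have hd0 : ∀ q, d q ≠ 0 := fun q => hd j₀ q ▸ (orderOf_pos _).ne'
  have hd1 : ∀ q, d q ≠ 1 := fun q =>
    hd j₀ q ▸ orderOf_entry_ne_one (hgen j₀) (by simpa only [hd] using hdcop) q
  have hdinj : Function.Injective d := fun q q' h => by
    by_contra hqq
    exact hd1 q' ((Nat.coprime_self _).1 (h ▸ hdcop q q' hqq))
  have hsum : ∑ q, (d q : ℚ)⁻¹ < 1 := (sum_inv_lt_one_or_exists_perm d hd1 hd0 hdcop).resolve_right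
    fun ⟨s, hs⟩ => not_type_two_three_five hna hr hd hdinj hgen hineq s hs
  have : Nonempty (Fin k) := ⟨⟨0, by omega⟩⟩
  obtain ⟨f, τ, hf, hff⟩ := exists_injective_perm_forall_letter r k hr hk2 hk6
  exact ⟨_, _, isGenTriple_permutedEntry hna hd hdinj hgen hineq f hf,
    isHyperbolic_permutedEntry hd hsum f,
    isGenTriple_permutedEntry hna hd hdinj hgen hineq (τ ∘ f) (τ.injective.comp hf),
    isHyperbolic_permutedEntry hd hsum (τ ∘ f),
    sigmaSet_inter_permutedEntry hd hdcop f (τ ∘ f) hff⟩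
end

section
/- Let H be a finite group, let X, Y, Z be conjugacy classes of H with representatives x, y, z, and let (ρ_i)_{i∈I} be a finite family of pairwise non-isomorphic irreducible finite-dimensional complex representations of H such that every irreducible finite-dimensional complex representation of H is isomorphic to some ρ_i; write χ_i for the character of ρ_i. Then the number of triples (a,b,c) ∈ X × Y × Z with a·b·c = 1 equals (|X|·|Y|·|Z| / |H|) · Σ_{i∈I} χ_i(x)·χ_i(y)·χ_i(z) / χ_i(1). -/
open CategoryTheory

universe u v

namespace Representation

/-- The character of a representation is the sum of the characters of two complementary
subrepresentations. -/
theorem character_eq_add_of_isCompl {k G V : Type*} [Field k] [Group G] [AddCommGroup V]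
    [Module k V] [FiniteDimensional k V] (ρ : Representation k G V) {p q : Subrepresentation ρ}
    (h : IsCompl p q) :
    ρ.character = p.toRepresentation.character + q.toRepresentation.character := by
  have hc : IsCompl p.toSubmodule q.toSubmodule := by
    constructor
    · rw [disjoint_iff]
      exact congrArg Subrepresentation.toSubmodule h.inf_eq_bot
    · rw [codisjoint_iff]
      exact congrArg Subrepresentation.toSubmodule h.sup_eq_top
  ext g
  let e := Submodule.prodEquivOfIsCompl _ _ hc
  have he : e.conj ((p.toRepresentation g).prodMap (q.toRepresentation g)) = ρ g := by
    ext v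
    obtain ⟨⟨a, b⟩, rfl⟩ := e.surjective v
    rw [LinearEquiv.conj_apply_apply, LinearEquiv.symm_apply_apply]
    simp only [e, LinearMap.prodMap_apply, Submodule.coe_prodEquivOfIsCompl', map_add]
    rfl
  rw [character, ← he, LinearMap.trace_conj', LinearMap.trace_prodMap']
  rfl

theorem character_leftRegular {k G : Type*} [Field k] [Group G] [Fintype G] [DecidableEq G]
    (g : G) :
    (leftRegular k G).character g = if g = 1 then (Nat.card G : k) else 0 := by
  rw [character, LinearMap.trace_eq_matrix_trace k (MonoidAlgebra.basis G k), Matrix.trace]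
  have h (x : G) : LinearMap.toMatrix (MonoidAlgebra.basis G k) (MonoidAlgebra.basis G k)
      (leftRegular k G g) x x = if g = 1 then 1 else 0 := by
    rw [LinearMap.toMatrix_apply, MonoidAlgebra.basis_apply, ofMulAction_single]
    simp [MonoidAlgebra.basis, Finsupp.single_apply]
  simp only [Matrix.diag_apply, h]
  split_ifs <;> simp

/-- An irreducible representation of a finite group is a simple object of `FDRep`. -/
theorem IsIrreducible.simple_of {k G : Type u} [Field k] [IsAlgClosed k] [CharZero k] [Group G]
    [Fintype G] {V : Type u} [AddCommGroup V] [Module k V] [FiniteDimensional k V]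
    (σ : Representation k G V) [IsIrreducible σ] : Simple (FDRep.of σ) := by
  have hne : (Nat.card G : k) ≠ 0 := NeZero.ne _
  have := invertibleOfNonzero hne
  rw [FDRep.simple_iff_char_is_norm_one]
  have h := char_orthonormal σ σ
  rw [if_pos ⟨Equiv.refl σ⟩, inv_mul_eq_one₀ hne] at h
  exact h.symm

/-- Every character of a finite group lies in the span of the irreducible characters. -/
theorem character_mem_span_of_simple {k G : Type u} [Field k] [IsAlgClosed k] [CharZero k]
    [Group G] [Fintype G] {I : Type*} (ρ : I → FDRep k G)
    (hall : ∀ W : FDRep k G, Simple W → ∃ i, Nonempty (W ≅ ρ i))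
    {V : Type u} [AddCommGroup V] [Module k V] [FiniteDimensional k V]
    (σ : Representation k G V) :
    σ.character ∈ Submodule.span k (Set.range fun i ↦ (ρ i).character) := by
  induction hn : Module.finrank k V using Nat.strong_induction_on generalizing V with
  | _ n ih =>
  subst hn
  by_cases hirr : IsIrreducible σ
  · obtain ⟨i, ⟨e⟩⟩ := hall _ (IsIrreducible.simple_of σ)
    have h : σ.character = (ρ i).character := FDRep.char_iso e
    rw [h]
    exact Submodule.subset_span ⟨i, rfl⟩
  rcases subsingleton_or_nontrivial V with hV | hV
  · have h : σ.character = 0 := by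
      ext g
      rw [character, Subsingleton.elim (σ g) 0, map_zero, Pi.zero_apply]
    rw [h]
    exact Submodule.zero_mem _
  have hlt (r : Subrepresentation σ) (hr : r ≠ ⊤) :
      Module.finrank k r.toSubmodule < Module.finrank k V :=
    Submodule.finrank_lt fun h ↦ hr (Subrepresentation.toSubmodule_injective h)
  have hnt : Nontrivial (Subrepresentation σ) := by
    refine ⟨⊥, ⊤, fun h ↦ ?_⟩
    exact bot_ne_top (α := Submodule k V) (congrArg Subrepresentation.toSubmodule h)
  obtain ⟨p, hpb, hpt⟩ : ∃ p : Subrepresentation σ, p ≠ ⊥ ∧ p ≠ ⊤ := by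
    by_contra! h
    exact hirr ⟨fun p ↦ or_iff_not_imp_left.mpr (h p)⟩
  obtain ⟨q, hpq⟩ := exists_isCompl p
  have hqt : q ≠ ⊤ := by
    rintro rfl
    exact hpb (eq_bot_of_isCompl_top hpq)
  rw [character_eq_add_of_isCompl σ hpq]
  exact Submodule.add_mem _ (ih _ (hlt p hpt) _ rfl) (ih _ (hlt q hqt) _ rfl)

end Representation

namespace FDRep

/-- The regular character is the sum of the irreducible characters weighted by their degrees. -/
theorem sum_char_one_mul_char {k G : Type u} [Field k] [IsAlgClosed k] [CharZero k]
    [Group G] [Fintype G] [DecidableEq G] {I : Type*} [Fintype I] (ρ : I → FDRep k G)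
    (hirr : ∀ i, Simple (ρ i))
    (hnoniso : ∀ i j, i ≠ j → ¬ Nonempty (ρ i ≅ ρ j))
    (hall : ∀ W : FDRep k G, Simple W → ∃ i, Nonempty (W ≅ ρ i)) (g : G) :
    ∑ i, (ρ i).character 1 * (ρ i).character g = if g = 1 then (Nat.card G : k) else 0 := by
  classical
  have hne : (Nat.card G : k) ≠ 0 := NeZero.ne _
  have := invertibleOfNonzero hne
  obtain ⟨c, hc⟩ := (Submodule.mem_span_range_iff_exists_fun k).mp
    (Representation.character_mem_span_of_simple ρ hall (Representation.leftRegular k G))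
  have hc' (g : G) :
      ∑ i, c i * (ρ i).character g = if g = 1 then (Nat.card G : k) else 0 := by
    rw [← Representation.character_leftRegular, ← hc]
    simp
  have hcoef (j : I) : c j = (ρ j).character 1 := by
    have horth (i : I) : (Nat.card G : k)⁻¹ *
        ∑ g : G, (ρ i).character g * (ρ j).character g⁻¹ = if i = j then 1 else 0 := by
      rw [char_orthonormal]
      refine if_congr ⟨fun h ↦ ?_, ?_⟩ rfl rfl
      · by_contra hij
        exact hnoniso i j hij h
      · rintro rfl
        exact ⟨Iso.refl _⟩
    calc c j = ∑ i, c i * if i = j then 1 else 0 := by simp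
      _ = (Nat.card G : k)⁻¹ *
          ∑ g : G, (∑ i, c i * (ρ i).character g) * (ρ j).character g⁻¹ := by
        simp_rw [← horth, Finset.sum_mul, Finset.mul_sum]
        rw [Finset.sum_comm]
        refine Finset.sum_congr rfl fun g _ ↦ Finset.sum_congr rfl fun i _ ↦ ?_
        ring
      _ = (ρ j).character 1 := by
        simp only [hc', ite_mul, zero_mul, Finset.sum_ite_eq', Finset.mem_univ, if_true, inv_one]
        rw [inv_mul_cancel_left₀ hne]
  simpa only [hcoef] using hc' g

/-- Schur's lemma for linear maps commuting with the action on a simple representation. -/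
theorem exists_eq_smul_one_of_commute {k : Type u} {G : Type v} [Field k] [IsAlgClosed k] [Group G]
    (V : FDRep k G) [Simple V] (f : V →ₗ[k] V) (hf : ∀ g, V.ρ g * f = f * V.ρ g) :
    ∃ c : k, f = c • (1 : V →ₗ[k] V) := by
  have hmem (f : V →ₗ[k] V) (hf : ∀ g, V.ρ g * f = f * V.ρ g) :
      f ∈ (Representation.linHom V.ρ V.ρ).invariants := by
    intro g
    rw [Representation.linHom_apply]
    change V.ρ g * (f * V.ρ g⁻¹) = f
    rw [← mul_assoc, hf, mul_assoc, ← map_mul, mul_inv_cancel, map_one, mul_one]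
  have hrank : Module.finrank k (Representation.linHom V.ρ V.ρ).invariants = 1 := by
    rw [(Representation.linHom.invariantsEquivFDRepHom V V).finrank_eq]
    exact finrank_endomorphism_simple_eq_one k V
  let e : (Representation.linHom V.ρ V.ρ).invariants := ⟨1, hmem 1 fun g ↦ by simp⟩
  have he : e ≠ 0 := by
    intro h
    have h1 : (1 : V →ₗ[k] V) = 0 := congrArg Subtype.val h
    have : Subsingleton (Representation.linHom V.ρ V.ρ).invariants := by
      refine ⟨fun a b ↦ Subtype.ext ?_⟩
      rw [← mul_one (a : V →ₗ[k] V), ← mul_one (b : V →ₗ[k] V), h1, mul_zero, mul_zero]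
    rw [Module.finrank_zero_of_subsingleton] at hrank
    exact zero_ne_one hrank
  obtain ⟨c, hc⟩ := (finrank_eq_one_iff_of_nonzero' e he).mp hrank ⟨f, hmem f hf⟩
  exact ⟨c, (congrArg Subtype.val hc).symm⟩

theorem char_one_ne_zero {k : Type u} {G : Type v} [Field k] [IsAlgClosed k] [CharZero k] [Group G]
    (V : FDRep k G) [Simple V] : V.character 1 ≠ 0 := by
  rw [char_one, Nat.cast_ne_zero]
  intro h
  have : Subsingleton V := Module.finrank_zero_iff.mp h
  apply id_nonzero V
  ext v
  exact Subsingleton.elim (α := V) _ _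

/-- A class sum acts on a simple representation by the scalar `|X| χ(x) / χ(1)`. -/
theorem sum_conjClass_ρ {k : Type u} {G : Type v} [Field k] [IsAlgClosed k] [CharZero k] [Group G]
    (V : FDRep k G) [Simple V] (x : G) (S : Finset G) (hS : ∀ h, h ∈ S ↔ IsConj x h) :
    ∑ a ∈ S, V.ρ a = ((S.card : k) * V.character x / V.character 1) • (1 : V →ₗ[k] V) := by
  obtain ⟨c, hc⟩ := V.exists_eq_smul_one_of_commute (∑ a ∈ S, V.ρ a) fun g ↦ by
    rw [Finset.mul_sum, Finset.sum_mul]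
    refine Finset.sum_equiv (MulAut.conj g).toEquiv (fun a ↦ ?_) fun a _ ↦ ?_
    · have h : IsConj a (g * a * g⁻¹) := isConj_iff.mpr ⟨g, rfl⟩
      rw [hS, hS]
      exact ⟨fun ha ↦ ha.trans h, fun ha ↦ ha.trans h.symm⟩
    · simp [← map_mul]
  have ht : (S.card : k) * V.character x = c * V.character 1 := by
    have := congrArg (LinearMap.trace k V) hc
    rw [map_sum, map_smul, smul_eq_mul, ← map_one V.ρ] at this
    refine Eq.trans ?_ this
    rw [← nsmul_eq_mul, ← Finset.sum_const]
    refine Finset.sum_congr rfl fun a ha ↦ ?_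
    obtain ⟨g, rfl⟩ := isConj_iff.mp ((hS a).mp ha)
    exact (V.char_conj x g).symm
  rw [hc, ht, mul_div_cancel_right₀ _ V.char_one_ne_zero]

end FDRep

/-- Frobenius's formula: for conjugacy classes `X, Y, Z` of a finite group `H` with
representatives `x, y, z`, and a complete family `(ρ i)` of pairwise non-isomorphic
irreducible complex representations of `H`, the number of triples `(a,b,c) ∈ X × Y × Z`
with `a·b·c = 1` equals `(|X|·|Y|·|Z|/|H|) · Σᵢ χᵢ(x)·χᵢ(y)·χᵢ(z)/χᵢ(1)`. -/
theorem frobenius_triple_count (H : Type) [Group H] [Fintype H] (x y z : H)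
    (X Y Z : Set H)
    (hX : X = {h | IsConj x h}) (hY : Y = {h | IsConj y h}) (hZ : Z = {h | IsConj z h})
    (I : Type) [Fintype I] (ρ : I → FDRep ℂ H)
    (hirr : ∀ i, Simple (ρ i))
    (hnoniso : ∀ i j, i ≠ j → ¬ Nonempty (ρ i ≅ ρ j))
    (hall : ∀ W : FDRep ℂ H, Simple W → ∃ i, Nonempty (W ≅ ρ i)) :
    (Nat.card {T : H × H × H //
        T.1 ∈ X ∧ T.2.1 ∈ Y ∧ T.2.2 ∈ Z ∧ T.1 * T.2.1 * T.2.2 = 1} : ℂ) =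
      ((Nat.card X : ℂ) * (Nat.card Y : ℂ) * (Nat.card Z : ℂ) / (Nat.card H : ℂ)) *
        ∑ i, (ρ i).character x * (ρ i).character y * (ρ i).character z /
          (ρ i).character 1 := by
  classical
  obtain ⟨A, hA⟩ : ∃ A : Finset H, ∀ h, h ∈ A ↔ IsConj x h :=
    ⟨Finset.univ.filter (IsConj x), by simp only [Finset.mem_filter_univ, implies_true]⟩
  obtain ⟨B, hB⟩ : ∃ B : Finset H, ∀ h, h ∈ B ↔ IsConj y h :=
    ⟨Finset.univ.filter (IsConj y), by simp only [Finset.mem_filter_univ, implies_true]⟩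
  obtain ⟨C, hC⟩ : ∃ C : Finset H, ∀ h, h ∈ C ↔ IsConj z h :=
    ⟨Finset.univ.filter (IsConj z), by simp only [Finset.mem_filter_univ, implies_true]⟩
  obtain rfl : X = A := by ext h; simp [hX, hA]
  obtain rfl : Y = B := by ext h; simp [hY, hB]
  obtain rfl : Z = C := by ext h; simp [hZ, hC]
  have hcount : (Nat.card {T : H × H × H // T.1 ∈ (A : Set H) ∧ T.2.1 ∈ (B : Set H) ∧
      T.2.2 ∈ (C : Set H) ∧ T.1 * T.2.1 * T.2.2 = 1} : ℂ) =
      ∑ a ∈ A, ∑ b ∈ B, ∑ c ∈ C, if a * b * c = 1 then (1 : ℂ) else 0 := by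
    have hcard : Nat.card {T : H × H × H // T.1 ∈ (A : Set H) ∧ T.2.1 ∈ (B : Set H) ∧
        T.2.2 ∈ (C : Set H) ∧ T.1 * T.2.1 * T.2.2 = 1} =
        ((A ×ˢ B ×ˢ C).filter fun T ↦ T.1 * T.2.1 * T.2.2 = 1).card := by
      refine Nat.subtype_card _ fun T ↦ ?_
      simp [and_assoc]
    rw [hcard, Finset.card_filter, Finset.sum_product]
    simp_rw [Finset.sum_product]
    push_cast
    rfl
  have htrace (i : I) : ∑ a ∈ A, ∑ b ∈ B, ∑ c ∈ C, (ρ i).character (a * b * c) =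
      (A.card * (ρ i).character x / (ρ i).character 1) *
        (B.card * (ρ i).character y / (ρ i).character 1) *
        (C.card * (ρ i).character z / (ρ i).character 1) * (ρ i).character 1 := by
    have := hirr i
    have h : ∑ a ∈ A, ∑ b ∈ B, ∑ c ∈ C, (ρ i).character (a * b * c) =
        LinearMap.trace ℂ (ρ i)
          ((∑ a ∈ A, (ρ i).ρ a) * (∑ b ∈ B, (ρ i).ρ b) * ∑ c ∈ C, (ρ i).ρ c) := by
      rw [Finset.sum_mul_sum]
      simp_rw [Finset.sum_mul, Finset.mul_sum, map_sum, ← map_mul]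
      rfl
    rw [h, FDRep.sum_conjClass_ρ _ x A hA, FDRep.sum_conjClass_ρ _ y B hB,
      FDRep.sum_conjClass_ρ _ z C hC, smul_mul_smul_comm, smul_mul_smul_comm, mul_one, mul_one,
      map_smul, smul_eq_mul, ← map_one (ρ i).ρ]
    rfl
  calc _ = ∑ a ∈ A, ∑ b ∈ B, ∑ c ∈ C, (Nat.card H : ℂ)⁻¹ *
        ∑ i, (ρ i).character 1 * (ρ i).character (a * b * c) := by
        rw [hcount]
        refine Finset.sum_congr rfl fun a _ ↦ Finset.sum_congr rfl fun b _ ↦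
          Finset.sum_congr rfl fun c _ ↦ ?_
        rw [FDRep.sum_char_one_mul_char ρ hirr hnoniso hall]
        split_ifs <;> simp
    _ = (Nat.card H : ℂ)⁻¹ * ∑ i, (ρ i).character 1 *
        ∑ a ∈ A, ∑ b ∈ B, ∑ c ∈ C, (ρ i).character (a * b * c) := by
        simp only [Finset.mul_sum, Finset.sum_comm (t := (Finset.univ : Finset I))]
    _ = _ := by
        simp only [htrace, Finset.mul_sum, Nat.card_eq_fintype_card, Fintype.card_coe,
          Finset.coe_sort_coe]
        refine Finset.sum_congr rfl fun i _ ↦ ?_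
        have := hirr i
        have h1 := (ρ i).char_one_ne_zero
        field_simp
end

section
/- Let q = p₀^e be a prime power with q ∈ {7, 8} or q ≥ 11, where p₀ is prime, and let d = gcd(2, q−1) and H = PSL₂(F_q). Then for each n ∈ {(q+1)/d, (q−1)/d}, H has a generating triple of type (n, n, p₀), i.e. there exist x, y, z ∈ H with x·y·z = 1, {x,y,z} generating H, ord x = ord y = n and ord z = p₀. -/
open scoped MatrixGroups

open Matrix in
theorem exists_pow_eq_linear {F K : Type*} [Field F] [Field K] [Algebra F K] {t : F} {ζ : K}
    (h0 : ζ ≠ 0) (ht : algebraMap F K t = ζ + ζ⁻¹) (g : SL(2, F))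
    (hg : (g : Matrix (Fin 2) (Fin 2) F).trace = t) (i : ℕ) :
    ∃ u v : F, ((g ^ i : SL(2, F)) : Matrix (Fin 2) (Fin 2) F) =
        u • 1 + v • (g : Matrix (Fin 2) (Fin 2) F) ∧
      ζ ^ i = algebraMap F K u + algebraMap F K v * ζ ∧
      ζ⁻¹ ^ i = algebraMap F K u + algebraMap F K v * ζ⁻¹ := by
  induction i with
  | zero => exact ⟨1, 0, by simp, by simp, by simp⟩
  | succ k ih =>
    obtain ⟨u, v, h1, h2, h3⟩ := ih
    have hsq : (g : Matrix (Fin 2) (Fin 2) F) * g = t • (g : Matrix (Fin 2) (Fin 2) F) - 1 := by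
      have hd := g.det_coe
      rw [det_fin_two] at hd
      rw [trace_fin_two] at hg
      subst hg
      ext i j
      fin_cases i <;> fin_cases j <;> simp [Matrix.mul_apply, Fin.sum_univ_two] <;>
        first | linear_combination -hd | ring
    refine ⟨-v, u + v * t, ?_, ?_, ?_⟩
    · rw [pow_succ, Matrix.SpecialLinearGroup.coe_mul, h1, add_mul, smul_mul_assoc,
        smul_mul_assoc, hsq, one_mul]
      module
    · rw [pow_succ, h2]
      simp only [map_neg, map_add, map_mul, ht]
      field_simp
      ring
    · rw [pow_succ, h3]
      simp only [map_neg, map_add, map_mul, ht]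
      field_simp
      ring

theorem map_trace_mul_pow {F K : Type*} [Field F] [Field K] [Algebra F K] {t : F} {ζ : K}
    (h0 : ζ ≠ 0) (hζ : ζ ^ 2 ≠ 1) (ht : algebraMap F K t = ζ + ζ⁻¹) (g : SL(2, F))
    (hg : (g : Matrix (Fin 2) (Fin 2) F).trace = t) (h : SL(2, F)) :
    ∃ α δ : K, (∀ i : ℕ, algebraMap F K ((h * g ^ i : SL(2, F)) : Matrix (Fin 2) (Fin 2) F).trace =
      α * ζ ^ i + δ * ζ⁻¹ ^ i) := by
  have hne : ζ - ζ⁻¹ ≠ 0 := by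
    intro h
    apply hζ
    field_simp at h
    linear_combination h
  set a := algebraMap F K (h : Matrix (Fin 2) (Fin 2) F).trace with ha
  set b := algebraMap F K ((h * g : SL(2, F)) : Matrix (Fin 2) (Fin 2) F).trace with hb
  refine ⟨(b - a * ζ⁻¹) / (ζ - ζ⁻¹), (a * ζ - b) / (ζ - ζ⁻¹), fun i ↦ ?_⟩
  obtain ⟨u, v, h1, h2, h3⟩ := exists_pow_eq_linear h0 ht g hg i
  rw [h2, h3, Matrix.SpecialLinearGroup.coe_mul, h1, mul_add, mul_smul_comm, mul_smul_comm, mul_one,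
    ← Matrix.SpecialLinearGroup.coe_mul, Matrix.trace_add, Matrix.trace_smul, Matrix.trace_smul,
    smul_eq_mul, smul_eq_mul, map_add, map_mul, map_mul, ← ha, ← hb,
    div_mul_eq_mul_div, div_mul_eq_mul_div, ← add_div, eq_div_iff hne]
  ring

open Matrix in
theorem coeff_eq_zero_of_scalar {F K : Type*} [Field F] [Field K] [Algebra F K] {t : F} {ζ : K}
    (h0 : ζ ≠ 0) (hζ : ζ ^ 2 ≠ 1) (ht : algebraMap F K t = ζ + ζ⁻¹) (g : SL(2, F))
    (hg : (g : Matrix (Fin 2) (Fin 2) F).trace = t) {u v r : F}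
    (h : u • 1 + v • (g : Matrix (Fin 2) (Fin 2) F) = scalar (Fin 2) r) : v = 0 := by
  by_contra hv
  have h01 := congrFun (congrFun h 0) 1
  have h10 := congrFun (congrFun h 1) 0
  have h00 := congrFun (congrFun h 0) 0
  have h11 := congrFun (congrFun h 1) 1
  simp [hv] at h01 h10 h00 h11
  have hd := g.det_coe
  rw [det_fin_two, h01, h10] at hd
  rw [trace_fin_two] at hg
  have he : g 0 0 = g 1 1 := mul_left_cancel₀ hv (by linear_combination h00 - h11)
  have hs : (g 0 0) ^ 2 = 1 := by rw [← he] at hd; linear_combination hd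
  have hs' := congrArg (algebraMap F K) hs
  rw [← hg, ← he, map_add] at ht
  rw [map_pow, map_one] at hs'
  apply hζ
  have : (ζ - algebraMap F K (g 0 0)) ^ 2 = 0 := by
    have := mul_inv_cancel₀ h0
    linear_combination (-ζ) * ht + hs' - this
  have := pow_eq_zero_iff (two_ne_zero) |>.1 this
  rw [sub_eq_zero.1 this, hs']

open Matrix in
theorem pow_mem_center_iff {F K : Type*} [Field F] [Field K] [Algebra F K] {t : F} {ζ : K}
    (h0 : ζ ≠ 0) (hζ : ζ ^ 2 ≠ 1) (ht : algebraMap F K t = ζ + ζ⁻¹) (g : SL(2, F))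
    (hg : (g : Matrix (Fin 2) (Fin 2) F).trace = t) (i : ℕ) :
    g ^ i ∈ Subgroup.center SL(2, F) ↔ (ζ ^ 2) ^ i = 1 := by
  obtain ⟨u, v, h1, h2, h3⟩ := exists_pow_eq_linear h0 ht g hg i
  rw [Matrix.SpecialLinearGroup.mem_center_iff, ← pow_mul, mul_comm, pow_mul, h1]
  constructor
  · rintro ⟨r, hr, h⟩
    have hv := coeff_eq_zero_of_scalar h0 hζ ht g hg h.symm
    have h00 := congrFun (congrFun h 0) 0
    simp [hv] at h00
    rw [h2, hv, ← h00, map_zero, zero_mul, add_zero, ← map_pow]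
    rw [Fintype.card_fin] at hr
    rw [hr, map_one]
  · intro h
    have hu : u ^ 2 = 1 ∧ v = 0 := by
      have hz : ζ⁻¹ ^ i = ζ ^ i := by
        rw [inv_pow]
        exact inv_eq_of_mul_eq_one_left (by rw [← h]; ring)
      have hv : algebraMap F K v * (ζ ^ 2 - 1) = 0 := by
        have h4 : algebraMap F K v * ζ⁻¹ = algebraMap F K v * ζ := by
          linear_combination hz - h3 + h2
        field_simp at h4
        linear_combination -h4
      have hv0 : v = 0 := by
        rcases mul_eq_zero.1 hv with h | h
        · simpa using h
        · exact absurd (sub_eq_zero.1 h) hζ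
      refine ⟨?_, hv0⟩
      apply (algebraMap F K).injective
      rw [h2, hv0, map_zero, zero_mul, add_zero] at h
      rw [map_pow, h, map_one]
    refine ⟨u, by simpa using hu.1, ?_⟩
    rw [hu.2]
    ext i j
    fin_cases i <;> fin_cases j <;> simp

theorem orderOf_mk_eq {F K : Type*} [Field F] [Field K] [Algebra F K] {t : F} {ζ : K}
    (h0 : ζ ≠ 0) (hζ : ζ ^ 2 ≠ 1) (ht : algebraMap F K t = ζ + ζ⁻¹) (g : SL(2, F))
    (hg : (g : Matrix (Fin 2) (Fin 2) F).trace = t) :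
    orderOf (g : PSL(2, F)) = orderOf (ζ ^ 2) := by
  rw [orderOf_eq_orderOf_iff]
  intro i
  rw [← pow_mem_center_iff h0 hζ ht g hg, ← QuotientGroup.mk_pow, QuotientGroup.eq_one_iff]

theorem pow_eq_pow_of_pow_eq_pow {F K : Type*} [Field F] [Field K] [Algebra F K] {t : F} {ζ : K}
    (h0 : ζ ≠ 0) (hζ : ζ ^ 2 ≠ 1) (ht : algebraMap F K t = ζ + ζ⁻¹) (g : SL(2, F))
    (hg : (g : Matrix (Fin 2) (Fin 2) F).trace = t) {i j : ℕ} (hij : g ^ i = g ^ j) :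
    ζ ^ i = ζ ^ j := by
  obtain ⟨u, v, h1, h2, -⟩ := exists_pow_eq_linear h0 ht g hg i
  obtain ⟨u', v', h1', h2', -⟩ := exists_pow_eq_linear h0 ht g hg j
  rw [hij, h1'] at h1
  have h : (u - u') • 1 + (v - v') • (g : Matrix (Fin 2) (Fin 2) F) = Matrix.scalar (Fin 2) 0 := by
    rw [map_zero, sub_smul, sub_smul, ← sub_eq_zero.2 h1.symm]
    abel
  have hv := coeff_eq_zero_of_scalar h0 hζ ht g hg h
  have h00 := congrFun (congrFun h 0) 0
  simp [hv] at h00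
  rw [h2, h2', sub_eq_zero.1 hv, sub_eq_zero.1 h00]

theorem exists_primitiveRoot_trace (F : Type*) [Field F] [Fintype F] {N : ℕ}
    (hN : N = Fintype.card F - 1 ∨ N = Fintype.card F + 1) :
    ∃ (ζ : AlgebraicClosure F) (t : F), ζ ≠ 0 ∧ orderOf ζ = N ∧
      algebraMap F (AlgebraicClosure F) t = ζ + ζ⁻¹ := by
  have hq : 1 < Fintype.card F := Fintype.one_lt_card
  have hcast : ((Fintype.card F : ℕ) : AlgebraicClosure F) = 0 := by
    rw [← map_natCast (algebraMap F (AlgebraicClosure F)), FiniteField.cast_card_eq_zero, map_zero]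
  have hN0 : (N : AlgebraicClosure F) ≠ 0 := by
    rcases hN with rfl | rfl
    · rw [Nat.cast_sub hq.le, hcast]; simp
    · rw [Nat.cast_add, hcast]; simp
  have : NeZero (N : AlgebraicClosure F) := ⟨hN0⟩
  obtain ⟨ζ, hζ⟩ := HasEnoughRootsOfUnity.exists_primitiveRoot (AlgebraicClosure F) N
  have hNne : N ≠ 0 := by rcases hN with rfl | rfl <;> omega
  have h0 : ζ ≠ 0 := hζ.ne_zero hNne
  have hfix : (ζ + ζ⁻¹) ^ Fintype.card F = ζ + ζ⁻¹ := by
    obtain ⟨p, hp⟩ := CharP.exists F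
    obtain ⟨n, hpp, hn⟩ := FiniteField.card F p
    have := Fact.mk hpp
    have : CharP (AlgebraicClosure F) p := charP_of_injective_algebraMap' F p
    rw [hn, add_pow_char_pow, ← hn, inv_pow]
    rcases hN with h | h
    · have : ζ ^ Fintype.card F = ζ := by
        rw [← Nat.sub_add_cancel hq.le, ← h, pow_succ, hζ.pow_eq_one, one_mul]
      rw [this]
    · have : ζ ^ Fintype.card F = ζ⁻¹ := by
        exact eq_inv_of_mul_eq_one_left (by rw [← pow_succ, ← h, hζ.pow_eq_one])
      rw [this, inv_inv, add_comm]
  have hsplit := FiniteField.X_pow_card_sub_X_natDegree_eq (AlgebraicClosure F) hq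
  have hne := FiniteField.X_pow_card_sub_X_ne_zero (AlgebraicClosure F) hq
  suffices h : ζ + ζ⁻¹ ∈ Set.range (algebraMap F (AlgebraicClosure F)) by
    obtain ⟨t, ht⟩ := h
    exact ⟨ζ, t, h0, hζ.eq_orderOf.symm, ht⟩
  classical
  have hroots : Finset.univ.image (algebraMap F (AlgebraicClosure F)) =
      (Polynomial.X ^ Fintype.card F - Polynomial.X :
        Polynomial (AlgebraicClosure F)).roots.toFinset := by
    apply Finset.eq_of_subset_of_card_le
    · intro x hx
      obtain ⟨y, -, rfl⟩ := Finset.mem_image.1 hx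
      rw [Multiset.mem_toFinset, Polynomial.mem_roots hne]
      simp [← map_pow, FiniteField.pow_card]
    · rw [Finset.card_image_of_injective _ (algebraMap F _).injective, Finset.card_univ]
      exact (Multiset.toFinset_card_le _).trans ((Polynomial.card_roots' _).trans hsplit.le)
  have hmem : ζ + ζ⁻¹ ∈ (Polynomial.X ^ Fintype.card F - Polynomial.X :
        Polynomial (AlgebraicClosure F)).roots.toFinset := by
    rw [Multiset.mem_toFinset, Polynomial.mem_roots hne]
    simp [hfix]
  rw [← hroots] at hmem
  obtain ⟨t, -, ht⟩ := Finset.mem_image.1 hmem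
  exact ⟨t, ht⟩

theorem card_le_two_of_quadratic_roots {K : Type*} [Field K] {a b c : K}
    (h : a ≠ 0 ∨ b ≠ 0 ∨ c ≠ 0) (s : Finset K) (hs : ∀ x ∈ s, a * x ^ 2 + b * x + c = 0) :
    s.card ≤ 2 := by
  set P : Polynomial K := Polynomial.C a * Polynomial.X ^ 2 + Polynomial.C b * Polynomial.X +
    Polynomial.C c with hP
  have hP0 : P ≠ 0 := by
    intro h0
    have h2 : P.coeff 2 = a := by simp [hP]
    have h1 : P.coeff 1 = b := by simp [hP, Polynomial.coeff_C]
    have h3 : P.coeff 0 = c := by simp [hP]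
    rw [h0, Polynomial.coeff_zero] at h1 h2 h3
    grind
  have hsub : s.val ⊆ P.roots := by
    intro x hx
    rw [Polynomial.mem_roots hP0]
    simpa [hP] using hs x hx
  exact (Polynomial.card_le_degree_of_subset_roots hsub).trans
    (Polynomial.natDegree_quadratic_le)

/-- The lower unitriangular matrix with off-diagonal entry `x`. -/
def lowerUnipotent {F : Type*} [Field F] (x : F) : SL(2, F) :=
  ⟨!![1, 0; x, 1], by simp [Matrix.det_fin_two]⟩

theorem coe_lowerUnipotent {F : Type*} [Field F] (x : F) :
    (lowerUnipotent x : Matrix (Fin 2) (Fin 2) F) = !![1, 0; x, 1] := rfl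

theorem lowerUnipotent_add {F : Type*} [Field F] (x y : F) :
    lowerUnipotent (x + y) = lowerUnipotent x * lowerUnipotent y := by
  ext i j
  fin_cases i <;> fin_cases j <;> simp [coe_lowerUnipotent]

theorem lowerUnipotent_injective {F : Type*} [Field F] :
    Function.Injective (lowerUnipotent : F → SL(2, F)) := by
  intro x y h
  simpa [coe_lowerUnipotent] using congrArg (fun g : SL(2, F) ↦ g 1 0) h

theorem eq_lowerUnipotent {F : Type*} [Field F] {g : SL(2, F)} (h00 : g 0 0 = 1)
    (h01 : g 0 1 = 0) : g = lowerUnipotent (g 1 0) := by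
  have hd := g.det_coe
  rw [Matrix.det_fin_two, h00, h01] at hd
  ext i j
  fin_cases i <;> fin_cases j <;> simp [coe_lowerUnipotent, h00, h01]
  linear_combination hd

/-- The additive group of those `x` for which the lower unitriangular matrix with entry `x`
lies in `G`. -/
def lowerParams {F : Type*} [Field F] (G : Subgroup SL(2, F)) : AddSubgroup F where
  carrier := {x | lowerUnipotent x ∈ G}
  zero_mem' := by
    have : lowerUnipotent (0 : F) = 1 := by
      ext i j
      fin_cases i <;> fin_cases j <;> simp [coe_lowerUnipotent]
    simp [this, G.one_mem]
  add_mem' := by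
    intro a b ha hb
    simp only [Set.mem_ofPred_eq] at *
    rw [lowerUnipotent_add]
    exact G.mul_mem ha hb
  neg_mem' := by
    intro x hx
    simp only [Set.mem_ofPred_eq] at *
    have : lowerUnipotent (-x) = (lowerUnipotent x)⁻¹ := by
      rw [eq_inv_iff_mul_eq_one, ← lowerUnipotent_add]
      ext i j
      fin_cases i <;> fin_cases j <;> simp [coe_lowerUnipotent]
    rw [this]
    exact G.inv_mem hx

theorem mem_lowerParams {F : Type*} [Field F] {G : Subgroup SL(2, F)} {x : F} :
    x ∈ lowerParams G ↔ lowerUnipotent x ∈ G := Iff.rfl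

open Classical in
/-- The elements of `G`. -/
noncomputable def elements {F : Type*} [Field F] [Fintype F] (G : Subgroup SL(2, F)) :
    Finset SL(2, F) := {g | g ∈ G}

open Classical in
/-- The lower triangular elements of `G`. -/
noncomputable def lowerTriangular {F : Type*} [Field F] [Fintype F] (G : Subgroup SL(2, F)) :
    Finset SL(2, F) := {g | g ∈ G ∧ g 0 1 = 0}

open Classical in
/-- The elements of the additive group `A`. -/
noncomputable def addElements {F : Type*} [Field F] [Fintype F] (A : AddSubgroup F) :
    Finset F := {x | x ∈ A}

open Classical in
/-- The scalars mapping the additive group `A` into itself. -/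
noncomputable def multipliers {F : Type*} [Field F] [Fintype F] (A : AddSubgroup F) :
    Finset F := {μ | ∀ x ∈ A, μ * x ∈ A}

open Classical in
/-- The nontrivial elements `g` of `G` of trace `2`, except those for which both `g` and `g * X`
have trace `0`. -/
noncomputable def transvections {F : Type*} [Field F] [Fintype F] (G : Subgroup SL(2, F))
    (X : SL(2, F)) : Finset SL(2, F) :=
  {g | g ∈ G ∧ g ≠ 1 ∧ (g : Matrix (Fin 2) (Fin 2) F).trace = 2 ∧
    ¬((g : Matrix (Fin 2) (Fin 2) F).trace = 0 ∧
      ((g * X : SL(2, F)) : Matrix (Fin 2) (Fin 2) F).trace = 0)}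

/-- If a torus generated by `X` lies in `G`, each of its cosets contains at most two of the
transvections of `G`. -/
theorem card_transvections_mul_le {F K : Type*} [Field F] [Fintype F] [Field K] [Algebra F K]
    {t : F} {ζ : K} (h0 : ζ ≠ 0) (hζ : ζ ^ 2 ≠ 1) (ht : algebraMap F K t = ζ + ζ⁻¹)
    {G : Subgroup SL(2, F)} {X : SL(2, F)} (hX : X ∈ G)
    (htr : (X : Matrix (Fin 2) (Fin 2) F).trace = t) :
    (transvections G X).card * orderOf ζ ≤ 2 * (elements G).card := by
  classical
  have hcard := Finset.card_product (transvections G X) (Finset.range (orderOf ζ))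
  rw [Finset.card_range] at hcard
  rw [← hcard]
  have hmaps : ∀ a ∈ transvections G X ×ˢ Finset.range (orderOf ζ),
      a.1 * X⁻¹ ^ a.2 ∈ elements G := by
    rintro ⟨τ, i⟩ h
    simp only [Finset.mem_product, transvections, Finset.mem_filter] at h
    simp only [elements, Finset.mem_filter, Finset.mem_univ, true_and]
    exact G.mul_mem h.1.2.1 (G.pow_mem (G.inv_mem hX) _)
  refine Finset.card_le_mul_card_image_of_maps_to hmaps 2 fun h _ ↦ ?_
  obtain ⟨α, δ, htrace⟩ := map_trace_mul_pow h0 hζ ht X htr h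
  rw [← Finset.card_image_of_injOn (f := fun a : SL(2, F) × ℕ ↦ ζ ^ a.2)]
  · have key : ∀ a ∈ (transvections G X ×ˢ Finset.range (orderOf ζ)).filter
        (fun a ↦ a.1 * X⁻¹ ^ a.2 = h), (α ≠ 0 ∨ (-2 : K) ≠ 0 ∨ δ ≠ 0) ∧
        α * (ζ ^ a.2) ^ 2 + (-2) * (ζ ^ a.2) + δ = 0 := by
      rintro ⟨τ, i⟩ ha
      simp only [Finset.mem_product, transvections, Finset.mem_filter, Finset.mem_univ,
        true_and] at ha
      obtain ⟨⟨⟨-, -, hτ2, hτ⟩, -⟩, rfl⟩ := ha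
      have h1 := htrace i
      have h2 := htrace (i + 1)
      rw [inv_pow, inv_mul_cancel_right, hτ2] at h1
      rw [pow_succ X, ← mul_assoc, inv_pow, inv_mul_cancel_right] at h2
      refine ⟨?_, ?_⟩
      · by_contra! hcon
        obtain ⟨rfl, h2', rfl⟩ := hcon
        rw [neg_eq_zero] at h2'
        have h2F : (2 : F) = 0 := by
          apply (algebraMap F K).injective
          rw [map_ofNat, map_zero, h2']
        apply hτ
        rw [hτ2]
        refine ⟨h2F, (algebraMap F K).injective ?_⟩
        simpa using h2
      · have hz : ζ ^ i ≠ 0 := pow_ne_zero _ h0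
        rw [map_ofNat, inv_pow] at h1
        field_simp at h1
        linear_combination -h1
    rcases Finset.eq_empty_or_nonempty ((transvections G X ×ˢ Finset.range (orderOf ζ)).filter
        (fun a ↦ a.1 * X⁻¹ ^ a.2 = h)) with he | ⟨a, ha⟩
    · rw [he]; simp
    · refine card_le_two_of_quadratic_roots (key a ha).1 _ ?_
      intro x hx
      obtain ⟨b, hb, rfl⟩ := Finset.mem_image.1 hx
      exact (key b hb).2
  · rintro ⟨τ, i⟩ ha ⟨τ', j⟩ hb hab
    simp only [Finset.coe_filter, Finset.mem_product, Finset.mem_range, Set.mem_ofPred_eq] at ha hb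
    have hij : i = j := pow_injOn_Iio_orderOf ha.1.2 hb.1.2 hab
    subst hij
    have : τ = τ' := mul_right_cancel (ha.2.trans hb.2.symm)
    rw [this]

theorem mem_elements {F : Type*} [Field F] [Fintype F] {G : Subgroup SL(2, F)} {g : SL(2, F)} :
    g ∈ elements G ↔ g ∈ G := by simp [elements]

theorem mem_lowerTriangular {F : Type*} [Field F] [Fintype F] {G : Subgroup SL(2, F)}
    {g : SL(2, F)} : g ∈ lowerTriangular G ↔ g ∈ G ∧ g 0 1 = 0 := by simp [lowerTriangular]

theorem mem_addElements {F : Type*} [Field F] [Fintype F] {A : AddSubgroup F} {x : F} :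
    x ∈ addElements A ↔ x ∈ A := by simp [addElements]

theorem mem_multipliers {F : Type*} [Field F] [Fintype F] {A : AddSubgroup F} {μ : F} :
    μ ∈ multipliers A ↔ ∀ x ∈ A, μ * x ∈ A := by simp [multipliers]

theorem inv_mul_apply_zero_one {F : Type*} [Field F] (g h : SL(2, F)) :
    (g⁻¹ * h) 0 1 = g 1 1 * h 0 1 - g 0 1 * h 1 1 := by
  rw [Matrix.SpecialLinearGroup.coe_mul, Matrix.SpecialLinearGroup.coe_inv,
    Matrix.adjugate_fin_two, Matrix.mul_apply, Fin.sum_univ_two]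
  simp
  ring

theorem inv_mul_apply_zero_zero {F : Type*} [Field F] (g h : SL(2, F)) :
    (g⁻¹ * h) 0 0 = g 1 1 * h 0 0 - g 0 1 * h 1 0 := by
  rw [Matrix.SpecialLinearGroup.coe_mul, Matrix.SpecialLinearGroup.coe_inv,
    Matrix.adjugate_fin_two, Matrix.mul_apply, Fin.sum_univ_two]
  simp
  ring

theorem apply_zero_one_eq_zero_of_conj {F : Type*} [Field F] {k : SL(2, F)} {x y : F} (hx : x ≠ 0)
    (h : k * lowerUnipotent x = lowerUnipotent y * k) : k 0 1 = 0 := by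
  have := congrArg (fun g : SL(2, F) ↦ g 0 0) h
  simp [coe_lowerUnipotent, Matrix.mul_apply, Fin.sum_univ_two] at this
  exact this.resolve_right hx

theorem trace_conj {F : Type*} [Field F] (h g : SL(2, F)) :
    ((h * g * h⁻¹ : SL(2, F)) : Matrix (Fin 2) (Fin 2) F).trace =
      (g : Matrix (Fin 2) (Fin 2) F).trace := by
  rw [Matrix.SpecialLinearGroup.coe_mul, Matrix.trace_mul_comm,
    ← Matrix.SpecialLinearGroup.coe_mul]
  simp

theorem trace_lowerUnipotent {F : Type*} [Field F] (x : F) :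
    (lowerUnipotent x : Matrix (Fin 2) (Fin 2) F).trace = 2 := by
  rw [coe_lowerUnipotent, Matrix.trace_fin_two]
  simp
  norm_num

theorem lowerUnipotent_zero {F : Type*} [Field F] : lowerUnipotent (0 : F) = 1 := by
  ext i j
  fin_cases i <;> fin_cases j <;> simp [coe_lowerUnipotent]

open Classical in
theorem card_elements_mul_le {F : Type*} [Field F] [Fintype F] {G : Subgroup SL(2, F)}
    (X : SL(2, F)) (m : ℕ)
    (hm : ∀ h ∈ G, m ≤ ((addElements (lowerParams G)).filter (fun x ↦ x ≠ 0 ∧ ¬((2 : F) = 0 ∧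
      ((h * lowerUnipotent x * h⁻¹ * X : SL(2, F)) : Matrix (Fin 2) (Fin 2) F).trace = 0))).card) :
    (elements G).card * m ≤ (lowerTriangular G).card * (transvections G X).card := by
  set S := (elements G).sigma (fun h ↦ (addElements (lowerParams G)).filter (fun x ↦ x ≠ 0 ∧
      ¬((2 : F) = 0 ∧
      ((h * lowerUnipotent x * h⁻¹ * X : SL(2, F)) : Matrix (Fin 2) (Fin 2) F).trace = 0)))
    with hS
  have h1 : (elements G).card * m ≤ S.card := by
    rw [hS, Finset.card_sigma, ← smul_eq_mul]
    exact Finset.card_nsmul_le_sum _ _ _ fun h hh ↦ hm h (mem_elements.1 hh)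
  refine h1.trans ?_
  have hmaps : ∀ a ∈ S, a.1 * lowerUnipotent a.2 * a.1⁻¹ ∈ transvections G X := by
    rintro ⟨h, x⟩ ha
    simp only [hS, Finset.mem_sigma, mem_elements, Finset.mem_filter, mem_addElements,
      mem_lowerParams] at ha
    obtain ⟨hh, hx, hx0, hn⟩ := ha
    simp only [transvections, Finset.mem_filter, Finset.mem_univ, true_and]
    refine ⟨G.mul_mem (G.mul_mem hh hx) (G.inv_mem hh), ?_, ?_, ?_⟩
    · intro hc
      rw [mul_inv_eq_one, mul_eq_left, ← lowerUnipotent_zero] at hc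
      exact hx0 (lowerUnipotent_injective hc)
    · rw [trace_conj, trace_lowerUnipotent]
    · rwa [trace_conj, trace_lowerUnipotent]
  refine Finset.card_le_mul_card_image_of_maps_to hmaps _ fun τ _ ↦ ?_
  rcases Finset.eq_empty_or_nonempty (S.filter (fun a ↦ a.1 * lowerUnipotent a.2 * a.1⁻¹ = τ))
    with he | ⟨⟨h₀, x₀⟩, ha₀⟩
  · rw [he]; simp
  · simp only [hS, Finset.mem_sigma, mem_elements, Finset.mem_filter] at ha₀
    refine Finset.card_le_card_of_injOn (fun a ↦ h₀⁻¹ * a.1) ?_ ?_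
    · rintro ⟨h, x⟩ ha
      simp only [hS, Finset.coe_filter, Set.mem_ofPred_eq, Finset.mem_sigma, mem_elements,
        Finset.mem_filter] at ha
      rw [SetLike.mem_coe, mem_lowerTriangular]
      refine ⟨G.mul_mem (G.inv_mem ha₀.1.1) ha.1.1, ?_⟩
      refine apply_zero_one_eq_zero_of_conj (y := x₀) ha.1.2.2.1 ?_
      have := ha.2.trans ha₀.2.symm
      rw [mul_inv_eq_iff_eq_mul] at this
      rw [mul_assoc, this]
      group
    · rintro ⟨h, x⟩ ha ⟨h', x'⟩ ha' hab
      simp only [hS, Finset.coe_filter, Set.mem_ofPred_eq] at ha ha'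
      have hh : h = h' := mul_left_cancel hab
      subst hh
      have := ha.2.trans ha'.2.symm
      rw [mul_left_inj, mul_right_inj] at this
      rw [lowerUnipotent_injective this]

open Classical in
theorem card_sub_le_card_filter {F : Type*} [Field F] [Fintype F] (A : AddSubgroup F)
    {X : SL(2, F)} (hX : (X : Matrix (Fin 2) (Fin 2) F).trace ≠ 0) (h : SL(2, F)) :
    (addElements A).card - (if (2 : F) = 0 then 2 else 1) ≤
      ((addElements A).filter (fun x ↦ x ≠ 0 ∧ ¬((2 : F) = 0 ∧
      ((h * lowerUnipotent x * h⁻¹ * X : SL(2, F)) : Matrix (Fin 2) (Fin 2) F).trace = 0))).card := by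
  set c : F := (h.1 * !![0, 0; 1, 0] * h⁻¹.1 * X.1).trace with hc
  have htr : ∀ x : F,
      ((h * lowerUnipotent x * h⁻¹ * X : SL(2, F)) : Matrix (Fin 2) (Fin 2) F).trace =
        (X : Matrix (Fin 2) (Fin 2) F).trace + x * c := by
    intro x
    have h1 : (lowerUnipotent x : Matrix (Fin 2) (Fin 2) F) = 1 + x • !![0, 0; 1, 0] := by
      ext i j
      fin_cases i <;> fin_cases j <;> simp [coe_lowerUnipotent]
    have h2 : h.1 * h⁻¹.1 = 1 := congrArg Subtype.val (mul_inv_cancel h)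
    rw [Matrix.SpecialLinearGroup.coe_mul, Matrix.SpecialLinearGroup.coe_mul,
      Matrix.SpecialLinearGroup.coe_mul, h1, mul_add, mul_smul_comm, add_mul, add_mul,
      smul_mul_assoc, smul_mul_assoc, mul_one, h2, one_mul, Matrix.trace_add, Matrix.trace_smul,
      smul_eq_mul]
  simp only [htr]
  rw [tsub_le_iff_right, ← Finset.card_filter_add_card_filter_not (s := addElements A)
    (fun x ↦ x ≠ 0 ∧ ¬((2 : F) = 0 ∧ (X : Matrix (Fin 2) (Fin 2) F).trace + x * c = 0))]
  gcongr
  split_ifs with h2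
  · refine (Finset.card_le_card (t := {0, -(X : Matrix (Fin 2) (Fin 2) F).trace / c}) ?_).trans
      Finset.card_le_two
    intro x hx
    simp only [Finset.mem_filter, h2, true_and, not_and, not_not] at hx
    simp only [Finset.mem_insert, Finset.mem_singleton]
    by_cases hx0 : x = 0
    · exact Or.inl hx0
    · right
      have := hx.2 hx0
      have hc0 : c ≠ 0 := by
        rintro h
        rw [h, mul_zero, add_zero] at this
        exact hX this
      rw [eq_div_iff hc0]
      linear_combination this
  · refine (Finset.card_le_card (t := {0}) ?_).trans (Finset.card_singleton _).le
    intro x hx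
    simp [h2] at hx
    simp [hx]

open Classical in
theorem card_lowerTriangular_le {F : Type*} [Field F] [Fintype F] (G : Subgroup SL(2, F)) :
    (lowerTriangular G).card ≤ (addElements (lowerParams G)).card *
      ((if (2 : F) = 0 then 1 else 2) * ((multipliers (lowerParams G)).card - 1)) := by
  set A := lowerParams G
  have hfib : ∀ a ∈ (lowerTriangular G).image (fun g ↦ g 0 0),
      ((lowerTriangular G).filter (fun g ↦ g 0 0 = a)).card ≤ (addElements A).card := by
    intro a ha
    obtain ⟨g₀, hg₀, rfl⟩ := Finset.mem_image.1 ha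
    rw [mem_lowerTriangular] at hg₀
    have hd₀ := g₀.det_coe
    rw [Matrix.det_fin_two, hg₀.2] at hd₀
    have key : ∀ g ∈ (lowerTriangular G).filter (fun g ↦ g 0 0 = g₀ 0 0),
        g₀⁻¹ * g = lowerUnipotent ((g₀⁻¹ * g) 1 0) := by
      intro g hg
      rw [Finset.mem_filter, mem_lowerTriangular] at hg
      apply eq_lowerUnipotent
      · rw [inv_mul_apply_zero_zero, hg₀.2, hg.2]
        linear_combination hd₀
      · rw [inv_mul_apply_zero_one, hg₀.2, hg.1.2]
        ring
    refine Finset.card_le_card_of_injOn (fun g ↦ (g₀⁻¹ * g) 1 0) ?_ ?_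
    · intro g hg
      rw [SetLike.mem_coe, mem_addElements, mem_lowerParams, ← key g hg]
      have hg' := (mem_lowerTriangular.1 (Finset.mem_filter.1 hg).1).1
      exact G.mul_mem (G.inv_mem hg₀.1) hg'
    · intro g hg g' hg' h
      have h' : (g₀⁻¹ * g) 1 0 = (g₀⁻¹ * g') 1 0 := h
      have := key g hg
      rw [h', ← key g' hg'] at this
      exact mul_left_cancel this
  refine (Finset.card_le_mul_card_image _ _ hfib).trans ?_
  gcongr
  have hmaps : ∀ a ∈ (lowerTriangular G).image (fun g ↦ g 0 0),
      a ^ 2 ∈ (multipliers A).erase 0 := by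
    intro a ha
    obtain ⟨g, hg, rfl⟩ := Finset.mem_image.1 ha
    rw [mem_lowerTriangular] at hg
    have hd := g.det_coe
    rw [Matrix.det_fin_two, hg.2] at hd
    rw [Finset.mem_erase, mem_multipliers]
    constructor
    · rintro h
      rw [pow_eq_zero_iff two_ne_zero] at h
      rw [h] at hd
      simp at hd
    · intro x hx
      rw [mem_lowerParams] at hx ⊢
      have : lowerUnipotent (g 0 0 ^ 2 * x) = g⁻¹ * lowerUnipotent x * g := by
        rw [mul_assoc, eq_inv_mul_iff_mul_eq]
        ext i j
        fin_cases i <;> fin_cases j <;>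
          simp [coe_lowerUnipotent, Matrix.mul_apply, Fin.sum_univ_two, hg.2]
        linear_combination (g 0 0 * x) * hd
      rw [this]
      exact G.mul_mem (G.mul_mem (G.inv_mem hg.1) hx) hg.1
  refine (Finset.card_le_mul_card_image_of_maps_to hmaps (if (2 : F) = 0 then 1 else 2)
    fun b _ ↦ ?_).trans ?_
  · rcases Finset.eq_empty_or_nonempty (((lowerTriangular G).image (fun g ↦ g 0 0)).filter
      (fun a ↦ a ^ 2 = b)) with he | ⟨a₀, ha₀⟩
    · rw [he]; simp
    · rw [Finset.mem_filter] at ha₀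
      have hsub : (((lowerTriangular G).image (fun g ↦ g 0 0)).filter
          (fun a ↦ a ^ 2 = b)) ⊆ {a₀, -a₀} := by
        intro a ha
        rw [Finset.mem_filter] at ha
        have := sq_eq_sq_iff_eq_or_eq_neg.1 (ha.2.trans ha₀.2.symm)
        simpa using this
      refine (Finset.card_le_card hsub).trans ?_
      split_ifs with h2
      · have : -a₀ = a₀ := by linear_combination -a₀ * h2
        simp [this]
      · exact Finset.card_le_two
  · have h0 : (0 : F) ∈ multipliers A := by
      rw [mem_multipliers]
      intro x _
      rw [zero_mul]
      exact A.zero_mem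
    rw [Finset.card_erase_of_mem h0]

theorem card_elements_le {F : Type*} [Field F] [Fintype F] (G : Subgroup SL(2, F)) :
    (elements G).card ≤ (lowerTriangular G).card * (Fintype.card F + 1) := by
  classical
  let f : SL(2, F) → Option F := fun g ↦ if g 0 1 = 0 then none else some (g 1 1 / g 0 1)
  have := Finset.card_le_mul_card_image_of_maps_to (f := f) (s := elements G) (t := Finset.univ)
    (fun _ _ ↦ Finset.mem_univ _) (lowerTriangular G).card ?_
  · simpa using this
  · intro b _
    rcases Finset.eq_empty_or_nonempty ((elements G).filter (fun g ↦ f g = b)) with he | ⟨g₀, hg₀⟩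
    · rw [he]; simp
    · refine Finset.card_le_card_of_injOn (fun g ↦ g₀⁻¹ * g) ?_
        (fun _ _ _ _ h ↦ mul_left_cancel h)
      intro g hg
      rw [SetLike.mem_coe, Finset.mem_filter, mem_elements] at hg
      rw [Finset.mem_filter, mem_elements] at hg₀
      rw [SetLike.mem_coe, mem_lowerTriangular]
      refine ⟨G.mul_mem (G.inv_mem hg₀.1) hg.1, ?_⟩
      rw [inv_mul_apply_zero_one]
      have hf := hg.2.trans hg₀.2.symm
      simp only [f] at hf
      split_ifs at hf with h1 h2 h2
      · rw [h1, h2]; ring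
      · rw [Option.some.injEq] at hf
        field_simp at hf
        linear_combination -hf


theorem mem_of_mul_mem {F : Type*} [Field F] [Fintype F] {A : AddSubgroup F}
    {μ : F} (hμ : ∀ x ∈ A, μ * x ∈ A) (h0 : μ ≠ 0) {f : F} (hf : μ * f ∈ A) : f ∈ A := by
  classical
  have himg : (addElements A).image (fun x ↦ μ * x) = addElements A := by
    refine Finset.eq_of_subset_of_card_le ?_ ?_
    · intro y hy
      obtain ⟨x, hx, rfl⟩ := Finset.mem_image.1 hy
      exact mem_addElements.2 (hμ x (mem_addElements.1 hx))
    · rw [Finset.card_image_of_injective _ (mul_right_injective₀ h0)]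
  rw [← mem_addElements, ← himg] at hf
  obtain ⟨x, hx, hxf⟩ := Finset.mem_image.1 hf
  rw [← mul_left_cancel₀ h0 hxf]
  exact mem_addElements.1 hx

theorem card_multipliers_le {F : Type*} [Field F] [Fintype F] {A : AddSubgroup F} {x : F}
    (hx : x ∈ A) (h0 : x ≠ 0) : (multipliers A).card ≤ (addElements A).card :=
  Finset.card_le_card_of_injOn (fun μ ↦ μ * x)
    (fun _ hμ ↦ mem_addElements.2 (mem_multipliers.1 hμ x hx))
    (fun _ _ _ _ h ↦ mul_right_cancel₀ h0 h)

theorem card_addElements_mul_card_multipliers_le {F : Type*} [Field F] [Fintype F]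
    {A : AddSubgroup F} (hA : A ≠ ⊤) :
    (addElements A).card * (multipliers A).card ≤ Fintype.card F := by
  classical
  obtain ⟨f, hf⟩ : ∃ f, f ∉ A := by
    by_contra! h
    exact hA (A.eq_top_iff'.2 h)
  rw [← Finset.card_product, ← Finset.card_univ]
  refine Finset.card_le_card_of_injOn (fun a ↦ a.1 + a.2 * f) (fun _ _ ↦ Finset.mem_univ _) ?_
  rintro ⟨a, μ⟩ h ⟨b, ν⟩ h' hab
  simp only [Finset.coe_product, Set.mem_prod, SetLike.mem_coe, mem_addElements,
    mem_multipliers] at h h' hab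
  have hμν : μ = ν := by
    by_contra hne
    refine hf (mem_of_mul_mem (μ := μ - ν) ?_ (sub_ne_zero.2 hne) ?_)
    · intro x hx
      rw [sub_mul]
      exact A.sub_mem (h.2 x hx) (h'.2 x hx)
    · have : (μ - ν) * f = b - a := by linear_combination hab
      rw [this]
      exact A.sub_mem h'.1 h.1
  subst hμν
  rw [add_left_inj] at hab
  rw [hab]

theorem two_le_card_multipliers {F : Type*} [Field F] [Fintype F] (A : AddSubgroup F) :
    2 ≤ (multipliers A).card := by
  classical
  rw [← Finset.card_pair (zero_ne_one (α := F))]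
  refine Finset.card_le_card ?_
  intro μ hμ
  rw [mem_multipliers]
  intro x hx
  simp only [Finset.mem_insert, Finset.mem_singleton] at hμ
  rcases hμ with rfl | rfl
  · rw [zero_mul]; exact A.zero_mem
  · rwa [one_mul]

theorem card_addElements_dvd {F : Type*} [Field F] [Fintype F] (A : AddSubgroup F) :
    (addElements A).card ∣ Fintype.card F := by
  classical
  have h := A.card_addSubgroup_dvd_card
  rw [Nat.card_eq_fintype_card, Nat.card_eq_fintype_card] at h
  convert h
  rw [Fintype.card_subtype]
  congr

/-- The companion matrix of `X ^ 2 - t * X + 1`. -/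
def companionSL {F : Type*} [Field F] (t : F) : SL(2, F) :=
  ⟨!![0, -1; 1, t], by simp [Matrix.det_fin_two]⟩

/-- A matrix of trace `s` whose product with a companion matrix is minus a lower unitriangular
matrix. -/
def coCompanionSL {F : Type*} [Field F] (s : F) : SL(2, F) :=
  ⟨!![s, -1; 1, 0], by simp [Matrix.det_fin_two]⟩

theorem coe_companionSL {F : Type*} [Field F] (t : F) :
    (companionSL t : Matrix (Fin 2) (Fin 2) F) = !![0, -1; 1, t] := rfl

theorem coe_coCompanionSL {F : Type*} [Field F] (s : F) :
    (coCompanionSL s : Matrix (Fin 2) (Fin 2) F) = !![s, -1; 1, 0] := rfl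

theorem companionSL_mul_coCompanionSL {F : Type*} [Field F] (t s : F) :
    companionSL t * coCompanionSL s = -lowerUnipotent (-(s + t)) := by
  ext i j
  fin_cases i <;> fin_cases j <;>
    simp [coe_companionSL, coe_coCompanionSL, coe_lowerUnipotent]

theorem not_commute_companionSL {F : Type*} [Field F] {t s : F} (h : s + t ≠ 0) :
    ¬Commute (companionSL t) (coCompanionSL s) := by
  intro hc
  have := congrArg (fun g : SL(2, F) ↦ g 0 1) hc.eq
  simp [coe_companionSL, coe_coCompanionSL] at this
  apply h
  linear_combination this

theorem not_commute_companionSL_sq {F : Type*} [Field F] {t s : F} (h : s + t ≠ 0) (hs : s ≠ 0) :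
    ¬Commute (companionSL t) (coCompanionSL s ^ 2) := by
  intro hc
  have := congrArg (fun g : SL(2, F) ↦ g 0 1) hc.eq
  simp [coe_companionSL, coe_coCompanionSL, pow_two] at this
  apply mul_ne_zero hs h
  linear_combination this

theorem eq_top_of_companionSL_mem {F : Type*} [Field F] {G : Subgroup SL(2, F)} {t : F}
    (ht : companionSL t ∈ G) (hA : lowerParams G = ⊤) : G = ⊤ := by
  have hL : ∀ x, lowerUnipotent x ∈ G := fun x ↦ by
    rw [← mem_lowerParams, hA]
    exact AddSubgroup.mem_top x
  have hw : companionSL (0 : F) ∈ G := by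
    have : companionSL (0 : F) = lowerUnipotent t * companionSL t := by
      ext i j
      fin_cases i <;> fin_cases j <;> simp [coe_companionSL, coe_lowerUnipotent]
    rw [this]
    exact G.mul_mem (hL t) ht
  have hne : ∀ g : SL(2, F), g 0 1 ≠ 0 → g ∈ G := by
    intro g hg
    have hd := g.det_coe
    rw [Matrix.det_fin_two] at hd
    have : g = lowerUnipotent ((g 1 1 - 1) / g 0 1) * (companionSL 0 * lowerUnipotent (-g 0 1) *
        (companionSL 0)⁻¹) * lowerUnipotent ((g 0 0 - 1) / g 0 1) := by
      ext i j
      fin_cases i <;> fin_cases j <;>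
        simp [coe_companionSL, coe_lowerUnipotent, Matrix.adjugate_fin_two] <;> field_simp <;>
        first | ring1 | linear_combination -hd
    rw [this]
    exact G.mul_mem (G.mul_mem (hL _) (G.mul_mem (G.mul_mem hw (hL _)) (G.inv_mem hw))) (hL _)
  rw [Subgroup.eq_top_iff']
  intro g
  by_cases hg : g 0 1 = 0
  · have hd := g.det_coe
    rw [Matrix.det_fin_two, hg, zero_mul, sub_zero] at hd
    have h := hne (g * companionSL 0) (by
      simp [coe_companionSL, Matrix.mul_apply, Fin.sum_univ_two]
      rintro h
      rw [h, zero_mul] at hd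
      exact zero_ne_one hd)
    exact (G.mul_mem_cancel_right hw).1 h
  · exact hne g hg

theorem three_mul_card_zpowers_le {H : Type*} [Group H] {x y : H} (hxy : ¬Commute x y)
    (hxy2 : ¬Commute x (y ^ 2)) {S : Finset H} (hS : ∀ i j : ℕ, x ^ i * y ^ j ∈ S) :
    3 * orderOf x ≤ S.card := by
  have hc := Finset.card_product (Finset.range 3) (Finset.range (orderOf x))
  rw [Finset.card_range, Finset.card_range] at hc
  rw [← hc]
  have hlt : ∀ i j k l : ℕ, l < k → k < 3 → x ^ i * y ^ k = x ^ j * y ^ l → False := by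
    intro i j k l hlk hk h
    have h1 : y ^ (k - l) = (x ^ i)⁻¹ * x ^ j := by
      rw [pow_sub _ hlk.le, ← mul_inv_eq_iff_eq_mul.2 (h.trans rfl), eq_inv_mul_iff_mul_eq,
        ← mul_assoc, h, mul_inv_cancel_right]
    have h2 : Commute x (y ^ (k - l)) := by
      rw [h1]
      exact (((Commute.refl x).pow_right i).inv_right).mul_right ((Commute.refl x).pow_right j)
    have : k - l = 1 ∨ k - l = 2 := by omega
    rcases this with h | h <;> rw [h] at h2
    · exact hxy (by simpa using h2)
    · exact hxy2 h2
  refine Finset.card_le_card_of_injOn (fun a ↦ x ^ a.2 * y ^ a.1) (fun a _ ↦ hS a.2 a.1) ?_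
  rintro ⟨k, i⟩ h ⟨l, j⟩ h' hab
  simp only [Finset.coe_product, Set.mem_prod, Finset.coe_range, Set.mem_Iio] at h h' hab
  rcases lt_trichotomy l k with hlk | rfl | hlk
  · exact (hlt i j k l hlk h.1 hab).elim
  · rw [mul_left_inj] at hab
    rw [pow_injOn_Iio_orderOf h.2 h'.2 hab]
  · exact (hlt j i l k hlk h'.1 hab.symm).elim

theorem lowerParams_numerics_odd {q y l g N T E : ℕ} (hq : q = 7 ∨ q = 8 ∨ 11 ≤ q) (hodd : Odd q)
    (hN : q - 1 ≤ N) (hE : 0 < E) (h₁ : E * (y - 1) ≤ g * T) (h₂ : T * N ≤ 2 * E)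
    (h₃ : g ≤ y * (2 * (l - 1))) (hl : 2 ≤ l) (hly : l ≤ y) (hyl : y * l ≤ q) (hy : y ∣ q) :
    False := by
  have h₄ : (y - 1) * N ≤ 2 * g := by
    refine Nat.le_of_mul_le_mul_left ?_ hE
    calc E * ((y - 1) * N) = E * (y - 1) * N := by ring
      _ ≤ g * T * N := by gcongr
      _ = g * (T * N) := by ring
      _ ≤ g * (2 * E) := by gcongr
      _ = E * (2 * g) := by ring
  have h₅ : (y - 1) * (q - 1) ≤ 4 * (y * (l - 1)) := by
    calc (y - 1) * (q - 1) ≤ (y - 1) * N := by gcongr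
      _ ≤ 2 * g := h₄
      _ ≤ 2 * (y * (2 * (l - 1))) := by gcongr
      _ = 4 * (y * (l - 1)) := by ring
  obtain ⟨k, rfl⟩ := Nat.exists_eq_add_of_le' (show 1 ≤ y by omega)
  obtain ⟨m, rfl⟩ := Nat.exists_eq_add_of_le' (show 1 ≤ l by omega)
  obtain ⟨r, rfl⟩ := Nat.exists_eq_add_of_le' (show 1 ≤ q by omega)
  simp only [Nat.add_sub_cancel] at *
  have h₆ : r ≤ 4 * (m + 1) := by
    refine Nat.le_of_mul_le_mul_left (h₅.trans ?_) (show 0 < k by omega)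
    nlinarith
  have h₇ : (m + 1) * (m + 1) ≤ r + 1 := by nlinarith
  have hm : m ≤ 3 := by nlinarith
  have hr : r ≤ 16 := by omega
  have hk : k ≤ 8 := by nlinarith
  obtain ⟨c, hc⟩ := hodd
  interval_cases m <;> interval_cases r <;> first | omega | (interval_cases k <;> omega)

theorem lowerParams_numerics_even {e q y l g N T E : ℕ} (hq : q = 7 ∨ q = 8 ∨ 11 ≤ q)
    (hpow : q = 2 ^ e) (hN : q - 1 ≤ N) (hE : 0 < E) (h₁ : E * (y - 2) ≤ g * T)
    (h₂ : T * N ≤ 2 * E) (h₃ : g ≤ y * (1 * (l - 1))) (h₄ : 3 * N ≤ E) (h₅ : E ≤ g * (q + 1))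
    (hl : 2 ≤ l) (hly : l ≤ y) (hyl : y * l ≤ q) (hy : y ∣ q) :
    False := by
  have hy3 : y ≠ 3 := by
    rintro rfl
    rw [hpow] at hy
    have := Nat.prime_three.dvd_of_dvd_pow hy
    omega
  have h₆ : (y - 2) * N ≤ 2 * g := by
    refine Nat.le_of_mul_le_mul_left ?_ hE
    calc E * ((y - 2) * N) = E * (y - 2) * N := by ring
      _ ≤ g * T * N := by gcongr
      _ = g * (T * N) := by ring
      _ ≤ g * (2 * E) := by gcongr
      _ = E * (2 * g) := by ring
  have h₇ : (y - 2) * (q - 1) ≤ 2 * (y * (l - 1)) := by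
    calc (y - 2) * (q - 1) ≤ (y - 2) * N := by gcongr
      _ ≤ 2 * g := h₆
      _ ≤ 2 * (y * (1 * (l - 1))) := by gcongr
      _ = 2 * (y * (l - 1)) := by ring
  rcases (show y = 2 ∨ 4 ≤ y by omega) with rfl | hy4
  · have hl2 : l = 2 := by omega
    subst hl2
    have : g * (q + 1) ≤ 2 * (q + 1) := Nat.mul_le_mul_right _ (by simpa using h₃)
    omega
  · obtain ⟨k, rfl⟩ := Nat.exists_eq_add_of_le' (show 2 ≤ y by omega)
    obtain ⟨m, rfl⟩ := Nat.exists_eq_add_of_le' (show 1 ≤ l by omega)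
    obtain ⟨r, rfl⟩ := Nat.exists_eq_add_of_le' (show 1 ≤ q by omega)
    simp only [Nat.add_sub_cancel] at *
    have h₈ : r ≤ 4 * m := by
      refine Nat.le_of_mul_le_mul_left (h₇.trans ?_) (show 0 < k by omega)
      nlinarith
    have h₉ : (m + 1) * (m + 1) ≤ r + 1 := by nlinarith
    have hm : m ≤ 2 := by nlinarith
    have hr : r ≤ 8 := by omega
    interval_cases m <;> interval_cases r <;> omega

/-- The companion matrix of trace `t` together with `coCompanionSL s` generates `SL(2, F)` when
the eigenvalues of the former generate a torus of order at least `q - 1`. -/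
theorem closure_companionSL_eq_top {F K : Type*} [Field F] [Fintype F] [Field K] [Algebra F K]
    {p e : ℕ} [CharP F p] (hp : p.Prime) (hcard : Fintype.card F = p ^ e)
    (hq : Fintype.card F = 7 ∨ Fintype.card F = 8 ∨ 11 ≤ Fintype.card F)
    {t s : F} {ζ : K} (h0 : ζ ≠ 0) (hζ : ζ ^ 2 ≠ 1) (ht : algebraMap F K t = ζ + ζ⁻¹)
    (hord : Fintype.card F - 1 ≤ orderOf ζ) (ht0 : t ≠ 0) (hs0 : s ≠ 0) (hst : s + t ≠ 0) :
    Subgroup.closure {companionSL t, coCompanionSL s} = ⊤ := by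
  set G := Subgroup.closure {companionSL t, coCompanionSL s} with hG
  have hX : companionSL t ∈ G := Subgroup.subset_closure (by simp)
  have hY : coCompanionSL s ∈ G := Subgroup.subset_closure (by simp)
  refine eq_top_of_companionSL_mem hX ?_
  by_contra hA
  have htr : (companionSL t : Matrix (Fin 2) (Fin 2) F).trace = t := by
    simp [coe_companionSL, Matrix.trace_fin_two]
  obtain ⟨x, hx, hx0⟩ : ∃ x ∈ lowerParams G, x ≠ 0 := by
    have hXY := companionSL_mul_coCompanionSL t s
    by_cases h2 : (2 : F) = 0
    · refine ⟨-(s + t), ?_, neg_ne_zero.2 hst⟩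
      have : lowerUnipotent (-(s + t)) = companionSL t * coCompanionSL s := by
        rw [hXY]
        have hneg : ∀ a : F, -a = a := fun a ↦ by linear_combination -a * h2
        ext i j
        rw [Matrix.SpecialLinearGroup.coe_neg, Matrix.neg_apply]
        exact (hneg _).symm
      rw [mem_lowerParams, this]
      exact G.mul_mem hX hY
    · refine ⟨-(s + t) + -(s + t), ?_, ?_⟩
      · have : lowerUnipotent (-(s + t) + -(s + t)) = (companionSL t * coCompanionSL s) *
            (companionSL t * coCompanionSL s) := by
          rw [hXY, neg_mul_neg, lowerUnipotent_add]
        rw [mem_lowerParams, this]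
        exact G.mul_mem (G.mul_mem hX hY) (G.mul_mem hX hY)
      · rw [← two_mul]
        exact mul_ne_zero h2 (neg_ne_zero.2 hst)
  have hE : 0 < (elements G).card := Finset.card_pos.2 ⟨1, mem_elements.2 G.one_mem⟩
  have h₁ := card_elements_mul_le (G := G) (companionSL t) _
    (fun h _ ↦ card_sub_le_card_filter (lowerParams G) (htr.trans_ne ht0) h)
  have h₂ := card_transvections_mul_le h0 hζ ht hX htr
  have h₃ := card_lowerTriangular_le G
  have hl := two_le_card_multipliers (lowerParams G)
  have hly := card_multipliers_le hx hx0
  have hyl := card_addElements_mul_card_multipliers_le hA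
  have hy := card_addElements_dvd (lowerParams G)
  by_cases h2 : (2 : F) = 0
  · rw [if_pos h2] at h₁ h₃
    have hp2 : p = 2 := by
      have : p ∣ 2 := (CharP.cast_eq_zero_iff F p 2).1 (by exact_mod_cast h2)
      exact (Nat.prime_dvd_prime_iff_eq hp Nat.prime_two).1 this
    subst hp2
    have h₄ : 3 * orderOf (companionSL t) ≤ (elements G).card :=
      three_mul_card_zpowers_le (not_commute_companionSL hst)
        (not_commute_companionSL_sq hst hs0)
        fun i j ↦ mem_elements.2 (G.mul_mem (G.pow_mem hX i) (G.pow_mem hY j))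
    have h₅ : orderOf ζ ≤ orderOf (companionSL t) := by
      refine Nat.le_of_dvd (orderOf_pos _) (orderOf_dvd_of_pow_eq_one ?_)
      have := pow_eq_pow_of_pow_eq_pow h0 hζ ht _ htr (i := orderOf (companionSL t)) (j := 0)
        (by rw [pow_orderOf_eq_one, pow_zero])
      rw [this, pow_zero]
    exact lowerParams_numerics_even hq hcard hord hE h₁ h₂ h₃ (by omega) (card_elements_le G)
      hl hly hyl hy
  · rw [if_neg h2] at h₁ h₃
    have hp2 : p ≠ 2 := by
      rintro rfl
      exact h2 (by exact_mod_cast CharP.cast_eq_zero F 2)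
    have hodd : Odd (Fintype.card F) := by
      rw [hcard]
      exact (hp.odd_of_ne_two hp2).pow
    exact lowerParams_numerics_odd hq hodd hord hE h₁ h₂ h₃ hl hly hyl hy

theorem lowerUnipotent_pow {F : Type*} [Field F] (x : F) (n : ℕ) :
    lowerUnipotent x ^ n = lowerUnipotent (n * x) := by
  induction n with
  | zero => rw [pow_zero, Nat.cast_zero, zero_mul, lowerUnipotent_zero]
  | succ k ih => rw [pow_succ, ih, ← lowerUnipotent_add, Nat.cast_succ, add_mul, one_mul]

theorem orderOf_mk_neg_lowerUnipotent {F : Type*} [Field F] {p : ℕ} [CharP F p] (hp : p.Prime)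
    {x : F} (hx : x ≠ 0) : orderOf ((-lowerUnipotent x : SL(2, F)) : PSL(2, F)) = p := by
  have := Fact.mk hp
  have hneg : ((-lowerUnipotent x : SL(2, F)) : PSL(2, F)) = (lowerUnipotent x : SL(2, F)) := by
    rw [QuotientGroup.eq, Matrix.SpecialLinearGroup.mem_center_iff]
    refine ⟨-1, by simp, ?_⟩
    have : (-lowerUnipotent x)⁻¹ * lowerUnipotent x = (-1 : SL(2, F)) := by
      rw [inv_mul_eq_iff_eq_mul, neg_mul_neg, mul_one]
    rw [this]
    ext i j
    fin_cases i <;> fin_cases j <;> simp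
  rw [hneg]
  refine orderOf_eq_prime ?_ ?_
  · rw [← QuotientGroup.mk_pow, lowerUnipotent_pow, CharP.cast_eq_zero, zero_mul,
      lowerUnipotent_zero, QuotientGroup.mk_one]
  · rw [Ne, QuotientGroup.eq_one_iff, Matrix.SpecialLinearGroup.mem_center_iff]
    rintro ⟨r, -, hr⟩
    have := congrFun (congrFun hr 1) 0
    simp [coe_lowerUnipotent] at this
    exact hx this.symm

/-- For `q = p₀^e` with `q ∈ {7, 8}` or `q ≥ 11`, and `d = gcd(2, q−1)`, the group
`PSL₂(F_q)` has a generating triple of type `(n, n, p₀)` for each `n ∈ {(q+1)/d, (q−1)/d}`. -/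
theorem psl2_gen_triple_nn_p (F : Type*) [Field F] [Fintype F] (p₀ e : ℕ) (hp : p₀.Prime)
    (hcard : Fintype.card F = p₀ ^ e)
    (hq : Fintype.card F = 7 ∨ Fintype.card F = 8 ∨ 11 ≤ Fintype.card F)
    (n : ℕ)
    (hn : n = (Fintype.card F + 1) / Nat.gcd 2 (Fintype.card F - 1) ∨
          n = (Fintype.card F - 1) / Nat.gcd 2 (Fintype.card F - 1)) :
    ∃ x y z : PSL(2, F), x * y * z = 1 ∧
      Subgroup.closure ({x, y, z} : Set PSL(2, F)) = ⊤ ∧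
      orderOf x = n ∧ orderOf y = n ∧ orderOf z = p₀ := by
  have hchar : CharP F p₀ := by
    obtain ⟨p, hp'⟩ := CharP.exists F
    obtain ⟨k, hpp, hk⟩ := FiniteField.card F p
    have : p ∣ p₀ ^ e := by
      rw [← hcard, hk]
      exact dvd_pow_self p k.ne_zero
    rwa [← Nat.prime_eq_prime_of_dvd_pow hpp hp this]
  obtain ⟨N, hN, hnN⟩ : ∃ N, (N = Fintype.card F - 1 ∨ N = Fintype.card F + 1) ∧
      n = N / N.gcd 2 := by
    have hg : (Fintype.card F - 1).gcd 2 = Nat.gcd 2 (Fintype.card F - 1) := Nat.gcd_comm _ _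
    have hg' : (Fintype.card F + 1).gcd 2 = Nat.gcd 2 (Fintype.card F - 1) := by
      have : Fintype.card F + 1 = Fintype.card F - 1 + 2 := by omega
      rw [this, Nat.gcd_add_self_left, Nat.gcd_comm]
    rcases hn with rfl | rfl
    · exact ⟨_, Or.inr rfl, by rw [hg']⟩
    · exact ⟨_, Or.inl rfl, by rw [hg]⟩
  obtain ⟨ζ, t, h0, hord, ht⟩ := exists_primitiveRoot_trace F hN
  have hζpow : ∀ k, 0 < k → k < 6 → ζ ^ k ≠ 1 := by
    intro k hk hk6 h
    have := Nat.le_of_dvd hk (orderOf_dvd_of_pow_eq_one h)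
    omega
  have ht0 : t ≠ 0 := by
    rintro rfl
    apply hζpow 4 (by norm_num) (by norm_num)
    rw [map_zero] at ht
    field_simp at ht
    linear_combination (1 - ζ ^ 2) * ht
  obtain ⟨s, η, hη0, hη, hs, hηord, hs0, hst⟩ : ∃ (s : F) (η : AlgebraicClosure F), η ≠ 0 ∧
      η ^ 2 ≠ 1 ∧ algebraMap F (AlgebraicClosure F) s = η + η⁻¹ ∧ orderOf (η ^ 2) = n ∧
      s ≠ 0 ∧ s + t ≠ 0 := by
    by_cases h2 : (2 : F) = 0
    · have h2' : (2 : AlgebraicClosure F) = 0 := by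
        have := congrArg (algebraMap F (AlgebraicClosure F)) h2
        rwa [map_ofNat, map_zero] at this
      have hp2 : p₀ = 2 := by
        have : p₀ ∣ 2 := (CharP.cast_eq_zero_iff F p₀ 2).1 (by exact_mod_cast h2)
        exact (Nat.prime_dvd_prime_iff_eq hp Nat.prime_two).1 this
      have hNodd : Nat.Coprime N 2 := by
        have he : e ≠ 0 := by
          rintro rfl
          rw [pow_zero] at hcard
          omega
        have : 2 ∣ Fintype.card F := by
          rw [hcard, hp2]
          exact dvd_pow_self 2 he
        rw [Nat.coprime_two_right, Nat.odd_iff]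
        omega
      have hinv := mul_inv_cancel₀ h0
      refine ⟨t ^ 2, ζ ^ 2, pow_ne_zero _ h0, ?_, ?_, ?_, pow_ne_zero _ ht0, ?_⟩
      · rw [← pow_mul]
        exact hζpow 4 (by norm_num) (by norm_num)
      · rw [map_pow, ht, ← inv_pow]
        linear_combination 2 * hinv + h2'
      · have h4 : N.Coprime (2 * 2) := Nat.Coprime.mul_right hNodd hNodd
        rw [← pow_mul, Nat.Coprime.orderOf_pow (by rwa [hord]), hord, hnN, hNodd.gcd_eq_one,
          Nat.div_one]
      · intro h
        have h' : t * (t + 1) = 0 := by linear_combination h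
        have ht1 := (mul_eq_zero.1 h').resolve_left ht0
        apply hζpow 3 (by norm_num) (by norm_num)
        have ht1' := congrArg (algebraMap F (AlgebraicClosure F)) ht1
        rw [map_add, map_one, map_zero, ht] at ht1'
        linear_combination (ζ - 1) * ζ * ht1' - (ζ - 1) * hinv
    · refine ⟨t, ζ, h0, hζpow 2 (by norm_num) (by norm_num), ht, ?_, ht0, ?_⟩
      · rw [orderOf_pow' _ two_ne_zero, hord, hnN]
      · rw [← two_mul]
        exact mul_ne_zero h2 ht0
  have hζ2 := hζpow 2 (by norm_num) (by norm_num)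
  refine ⟨(companionSL t : SL(2, F)), (coCompanionSL s : SL(2, F)),
    ((companionSL t * coCompanionSL s : SL(2, F)) : PSL(2, F))⁻¹, ?_, ?_, ?_, ?_, ?_⟩
  · rw [QuotientGroup.mk_mul, mul_inv_cancel]
  · rw [eq_top_iff]
    have htop := closure_companionSL_eq_top hp hcard hq h0 hζ2 ht (by omega) ht0 hs0 hst
    have hmap := congrArg
      (Subgroup.map (QuotientGroup.mk' (Subgroup.center SL(2, F)))) htop
    rw [Subgroup.map_top_of_surjective _ (QuotientGroup.mk'_surjective _), MonoidHom.map_closure]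
      at hmap
    rw [← hmap]
    refine Subgroup.closure_mono ?_
    rintro _ ⟨g, hg, rfl⟩
    rcases hg with rfl | rfl
    · exact Or.inl rfl
    · exact Or.inr (Or.inl rfl)
  · rw [orderOf_mk_eq h0 hζ2 ht _ (by simp [coe_companionSL, Matrix.trace_fin_two]),
      orderOf_pow' _ two_ne_zero, hord, hnN]
  · rw [orderOf_mk_eq hη0 hη hs _ (by simp [coe_coCompanionSL, Matrix.trace_fin_two]), hηord]
  · rw [orderOf_inv, companionSL_mul_coCompanionSL]
    exact orderOf_mk_neg_lowerUnipotent hp (neg_ne_zero.2 hst)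
end
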